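/- arXiv:2210.12433 — 3 statements merged into one kernel-verified Lean document; each statement's English description precedes it below -/
import Mathlib

section
/- Let p be prime, q = p^h, and f ∈ ℤ_q[x_1, …, x_n] a nonzero polynomial of degree d ≥ 1. For m ≥ 1, let V = {X ∈ T_q^n : f(X) ≡ 0 (mod p^m)}. Then ord_q(|V|) ≥ ⌈(n − d·(p^m − 1)/(p − 1)) / (d·p^(m−1))⌉*, where ⌈t⌉* denotes the least nonnegative integer ≥ t. -/
open Finset

/-- If `k` has base-`p` digits `c_l`, the sequence `t ↦ ∑ c_l p ^ ((l + t) % h)` is `h`-periodic,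
congruent to `p ^ t * k` modulo `p ^ h - 1`, and its sum over a period is given by the digit sum. -/
theorem exists_digit_rotation {p h : ℕ} (hp : 1 < p) (k : ℕ) :
    ∃ r : ℕ → ℕ, (∀ t, r (t + h) = r t) ∧ (∀ t, r t ≡ p ^ t * k [MOD p ^ h - 1]) ∧
      (0 < k → ∀ t, 0 < r t) ∧
      (p - 1) * ∑ t ∈ range h, r t = (p ^ h - 1) * (Nat.digits p k).sum := by
  induction k using Nat.strong_induction_on with
  | _ k ih =>
    rcases Nat.eq_zero_or_pos k with rfl | hk
    · exact ⟨fun _ => 0, by simp, fun t => by simpa using Nat.ModEq.refl 0, by simp, by simp⟩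
    obtain ⟨r, hper, hmod, hpos, hsum⟩ := ih (k / p) (Nat.div_lt_self hk hp)
    have hpow : p ^ h ≡ 1 [MOD p ^ h - 1] :=
      ((Nat.modEq_iff_dvd' (Nat.one_le_pow _ _ (by omega))).2 dvd_rfl).symm
    have hpow_mod (t : ℕ) : p ^ (t % h) ≡ p ^ t [MOD p ^ h - 1] := by
      conv_rhs => rw [← Nat.mod_add_div t h, pow_add, pow_mul]
      simpa using ((hpow.pow (t / h)).mul_left (p ^ (t % h))).symm
    refine ⟨fun t => k % p * p ^ (t % h) + r (t + 1), ?_, ?_, ?_, ?_⟩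
    · intro t
      simp only [Nat.add_mod_right]
      rw [add_right_comm, hper]
    · intro t
      refine (((hpow_mod t).mul_left (k % p)).add (hmod (t + 1))).trans ?_
      conv_rhs => rw [← Nat.mod_add_div k p]
      rw [show k % p * p ^ t + p ^ (t + 1) * (k / p) = p ^ t * (k % p + p * (k / p)) by ring]
    · intro _ t
      by_cases h0 : k % p = 0
      · have : 0 < k / p := Nat.div_pos (Nat.le_of_dvd hk (Nat.dvd_of_mod_eq_zero h0)) (by omega)
        have := hpos this (t + 1)
        positivity
      · have : 0 < k % p * p ^ (t % h) := by positivity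
        positivity
    · have hshift : ∑ t ∈ range h, r (t + 1) = ∑ t ∈ range h, r t := by
        have h1 := sum_range_succ r h
        have h2 := sum_range_succ' r h
        have h3 := hper 0
        rw [zero_add] at h3
        omega
      have hgeom : (p - 1) * ∑ t ∈ range h, p ^ (t % h) = p ^ h - 1 := by
        rw [sum_congr rfl fun t ht => by rw [Nat.mod_eq_of_lt (mem_range.1 ht)],
          mul_comm, Nat.geomSum_eq hp, Nat.div_mul_cancel (Nat.sub_one_dvd_pow_sub_one p h)]
      rw [sum_add_distrib, hshift, ← mul_sum, mul_add, hsum, Nat.digits_def' hp hk, List.sum_cons,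
        mul_add, ← hgeom]
      ring

/-- Legendre's formula for multinomial coefficients. -/
theorem sub_one_mul_padicValNat_multinomial {p : ℕ} [Fact p.Prime] {J : Type*} (s : Finset J)
    (κ : J → ℕ) :
    (p - 1) * padicValNat p (Nat.multinomial s κ) + (Nat.digits p (∑ u ∈ s, κ u)).sum =
      ∑ u ∈ s, (Nat.digits p (κ u)).sum := by
  have hfac (a : ℕ) : (p - 1) * padicValNat p a.factorial + (Nat.digits p a).sum = a := by
    rw [sub_one_mul_padicValNat_factorial]
    have := Nat.digit_sum_le p a
    omega
  have hprod : padicValNat p (∏ u ∈ s, (κ u).factorial) =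
      ∑ u ∈ s, padicValNat p (κ u).factorial := by
    classical
    induction s using Finset.induction_on with
    | empty => simp
    | insert a s ha ih =>
      rw [prod_insert ha, sum_insert ha, padicValNat.mul (Nat.factorial_ne_zero _)
        (prod_ne_zero_iff.2 fun u _ => (κ u).factorial_ne_zero), ih]
  have hspec := congrArg (padicValNat p) (Nat.multinomial_spec s κ)
  rw [padicValNat.mul (prod_ne_zero_iff.2 fun u _ => (κ u).factorial_ne_zero)
    (Nat.multinomial_pos s κ).ne', hprod] at hspec
  have h1 := hfac (∑ u ∈ s, κ u)
  have h2 : ∑ u ∈ s, κ u = (p - 1) * ∑ u ∈ s, padicValNat p (κ u).factorial +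
      ∑ u ∈ s, (Nat.digits p (κ u)).sum := by
    rw [mul_sum, ← sum_add_distrib]
    exact sum_congr rfl fun u _ => (hfac _).symm
  rw [← hspec, mul_add] at h1
  omega

theorem dvd_sum_mul_of_modEq {α : Type*} {Q c : ℕ} (s : Finset α) {a b : α → ℕ} (w : α → ℕ)
    (hab : ∀ x, a x ≡ c * b x [MOD Q]) (hb : Q ∣ ∑ x ∈ s, b x * w x) :
    Q ∣ ∑ x ∈ s, a x * w x := by
  refine Nat.modEq_zero_iff_dvd.1 (Nat.ModEq.trans (b := c * ∑ x ∈ s, b x * w x) ?_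
    (Nat.modEq_zero_iff_dvd.2 (hb.mul_left _)))
  rw [mul_sum]
  refine Nat.ModEq.sum fun x _ => ?_
  rw [← mul_assoc]
  exact (hab x).mul_right _

/-- The valuation estimate behind the Ax–Katz theorem: `κ i` is a term of the multinomial expansion
of the `E`-th power of a polynomial with monomials `A i` of degree at most `d i`, where `w u` is the
exponent vector of the monomial `u`. -/
theorem pow_dvd_prod_multinomial_mul_pow {p h : ℕ} [Fact p.Prime] (hh : 0 < h)
    {ι σ J : Type*} [Fintype ι] [Fintype σ] (A : ι → Finset J) (w : J → σ → ℕ)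
    (κ : ι → J → ℕ) (d : ι → ℕ) {D E μ : ℕ} (hdD : ∀ i, d i ≤ D) (hD : 1 ≤ D)
    (hdeg : ∀ i, ∀ u ∈ A i, ∑ v, w u v ≤ d i) (hκ : ∀ i, ∑ u ∈ A i, κ i u = E)
    (hE : 0 < E) (hEdvd : p ^ h - 1 ∣ E) (hEdigits : (Nat.digits p E).sum ≤ h * (p - 1))
    (hμ : μ = 0 ∨ D * (μ - 1) + ∑ i, d i + 1 ≤ Fintype.card σ)
    (hexp : ∀ v, p ^ h - 1 ∣ ∑ i, ∑ u ∈ A i, κ i u * w u v) :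
    p ^ (h * μ) ∣ (∏ i, Nat.multinomial (A i) (κ i)) *
      (p ^ h) ^ #{v | ∑ i, ∑ u ∈ A i, κ i u * w u v = 0} := by
  have hp : 1 < p := (Fact.out : p.Prime).one_lt
  choose r _ hmod hpos hsum using exists_digit_rotation (p := p) (h := h) hp
  set Q := p ^ h - 1 with hQ
  have hQ0 : 0 < Q := Nat.sub_pos_of_lt (Nat.one_lt_pow hh.ne' hp)
  have hquot (i : ι) (t : ℕ) : ∃ e, ∑ u ∈ A i, r (κ i u) t = Q * (e + 1) := by
    obtain ⟨e, he⟩ : Q ∣ ∑ u ∈ A i, r (κ i u) t := by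
      simpa using dvd_sum_mul_of_modEq (A i) (fun _ => 1) (fun u => hmod (κ i u) t) (by simpa [hκ i] using hEdvd)
    obtain ⟨u, hu, hu0⟩ : ∃ u ∈ A i, 0 < κ i u := by
      by_contra! hcon
      have : ∑ u ∈ A i, κ i u = 0 := sum_eq_zero fun u hu => by have := hcon u hu; omega
      have := hκ i
      omega
    have hlt : 0 < ∑ u ∈ A i, r (κ i u) t :=
      sum_pos' (fun _ _ => Nat.zero_le _) ⟨u, hu, hpos _ hu0 t⟩
    rcases e with _ | e
    · omega
    · exact ⟨e, he⟩
  choose e he using hquot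
  set Z := #{v | ∑ i, ∑ u ∈ A i, κ i u * w u v = 0} with hZ
  set N := #{v | ¬ ∑ i, ∑ u ∈ A i, κ i u * w u v = 0} with hN
  have hZN : Z + N = Fintype.card σ := card_filter_add_card_filter_not _
  have hNle (t : ℕ) : N ≤ ∑ i, d i * (e i t + 1) := by
    have h1 : N * Q ≤ ∑ v, ∑ i, ∑ u ∈ A i, r (κ i u) t * w u v := by
      refine le_trans ?_ (sum_le_sum_of_subset (filter_subset
        (fun v => ¬ ∑ i, ∑ u ∈ A i, κ i u * w u v = 0) univ))
      rw [hN, ← smul_eq_mul]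
      refine card_nsmul_le_sum _ _ _ fun v hv => ?_
      have hv := (mem_filter.1 hv).2
      refine Nat.le_of_dvd ?_ ?_
      · simp only [sum_eq_zero_iff, mem_univ, true_implies, not_forall] at hv
        obtain ⟨i, u, hu, hne⟩ := hv
        have hne := mul_ne_zero_iff.1 hne
        refine sum_pos' (fun _ _ => Nat.zero_le _) ⟨i, mem_univ _,
          sum_pos' (fun _ _ => Nat.zero_le _) ⟨u, hu, ?_⟩⟩
        exact Nat.mul_pos (hpos _ (Nat.pos_of_ne_zero hne.1) t) (Nat.pos_of_ne_zero hne.2)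
      · have := hexp v
        rw [sum_sigma'] at this ⊢
        exact dvd_sum_mul_of_modEq _ (fun x : (_ : ι) × J => w x.2 v) (fun x => hmod (κ x.1 x.2) t) this
    have h2 : ∑ v, ∑ i, ∑ u ∈ A i, r (κ i u) t * w u v ≤ (∑ i, d i * (e i t + 1)) * Q := by
      rw [sum_comm, sum_mul]
      refine sum_le_sum fun i _ => ?_
      rw [sum_comm, mul_assoc, mul_comm (e i t + 1), ← he, mul_sum]
      refine sum_le_sum fun u hu => ?_
      rw [← mul_sum, mul_comm (d i)]
      exact Nat.mul_le_mul_left _ (hdeg i u hu)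
    exact Nat.le_of_mul_le_mul_right (h1.trans h2) hQ0
  have hval (i : ι) : ∑ t ∈ range h, e i t ≤ padicValNat p (Nat.multinomial (A i) (κ i)) := by
    have h1 := sub_one_mul_padicValNat_multinomial (p := p) (A i) (κ i)
    rw [hκ i] at h1
    have h2 : Q * ∑ u ∈ A i, (Nat.digits p (κ i u)).sum =
        (p - 1) * (Q * (∑ t ∈ range h, e i t + h)) := by
      rw [mul_sum, ← sum_congr rfl fun u _ => hsum (κ i u), ← mul_sum, sum_comm,
        sum_congr rfl fun t _ => he i t, ← mul_sum, sum_add_distrib]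
      simp
    have h3 : ∑ u ∈ A i, (Nat.digits p (κ i u)).sum =
        (p - 1) * (∑ t ∈ range h, e i t + h) := by
      refine Nat.eq_of_mul_eq_mul_left hQ0 ?_
      rw [h2]
      ring
    refine le_of_mul_le_mul_left (a := p - 1) ?_ (by omega)
    rw [h3, mul_add, mul_comm _ h] at h1
    omega
  have htime (t : ℕ) : μ ≤ ∑ i, e i t + Z := by
    rcases hμ with rfl | hμ
    · exact Nat.zero_le _
    by_contra! hcon
    have h1 : N ≤ D * ∑ i, e i t + ∑ i, d i := by
      refine (hNle t).trans ?_
      rw [mul_sum, ← sum_add_distrib]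
      refine sum_le_sum fun i _ => ?_
      rw [mul_add, mul_one]
      gcongr
      exact hdD i
    have h2 : D * (∑ i, e i t + Z) ≤ D * (μ - 1) := Nat.mul_le_mul_left _ (by omega)
    have h3 : Z ≤ D * Z := Nat.le_mul_of_pos_left _ hD
    rw [mul_add] at h2
    omega
  have hle : h * μ ≤ ∑ i, ∑ t ∈ range h, e i t + h * Z := by
    have : ∑ t ∈ range h, μ ≤ ∑ t ∈ range h, (∑ i, e i t + Z) := sum_le_sum fun t _ => htime t
    rw [sum_add_distrib, sum_comm] at this
    simpa using this
  refine (pow_dvd_pow p hle).trans ?_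
  rw [pow_add, pow_mul, ← prod_pow_eq_pow_sum]
  exact mul_dvd_mul_right
    (prod_dvd_prod_of_dvd _ _ fun i _ => (pow_dvd_pow p (hval i)).trans pow_padicValNat_dvd) _

namespace WittVector

variable {p : ℕ} [Fact p.Prime] {F : Type*} [Field F]

local notation "𝕎" => WittVector p F
local notation "τ" => teichmuller p (R := F)

theorem teichmuller_injective : Function.Injective τ := fun x y hxy => by
  simpa using congrArg (fun z => z.coeff 0) hxy

variable [Fintype F] [CharP F p]

theorem constantCoeff_eq_zero_iff_dvd (x : 𝕎) : constantCoeff x = 0 ↔ (p : 𝕎) ∣ x := by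
  rw [← RingHom.mem_ker, ker_constantCoeff, Ideal.mem_span_singleton]

theorem pow_dvd_of_pow_dvd_natCast {L N : ℕ} (hdvd : (p : 𝕎) ^ L ∣ (N : 𝕎)) : p ^ L ∣ N := by
  induction L generalizing N with
  | zero => simp
  | succ L ih =>
    have hN : p ∣ N := by
      have := (constantCoeff_eq_zero_iff_dvd (N : 𝕎)).2
        ((dvd_pow_self _ L.succ_ne_zero).trans hdvd)
      rwa [map_natCast, CharP.cast_eq_zero_iff F p] at this
    obtain ⟨M, rfl⟩ := hN
    rw [pow_succ'] at hdvd ⊢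
    rw [Nat.cast_mul, mul_dvd_mul_iff_left (p_nonzero p F)] at hdvd
    exact mul_dvd_mul_left p (ih hdvd)

theorem sum_teichmuller_pow_eq_zero {e : ℕ} (he : ¬ Fintype.card F - 1 ∣ e) :
    ∑ x, τ x ^ e = 0 := by
  rw [← FiniteField.forall_pow_eq_one_iff F] at he
  push Not at he
  obtain ⟨g, hg⟩ := he
  have hshift : τ g ^ e * ∑ x, τ x ^ e = ∑ x, τ x ^ e := by
    rw [mul_sum]
    refine Fintype.sum_equiv (Equiv.mulLeft₀ (g : F) g.ne_zero) _ _ fun x => ?_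
    simp [mul_pow]
  by_contra hne
  rw [mul_eq_right₀ hne, ← map_pow, ← map_one τ] at hshift
  exact hg (Units.ext (by simpa using teichmuller_injective hshift))

variable {σ : Type*} [Fintype σ] [DecidableEq σ]

theorem pow_dvd_sum_prod_eval_pow {h : ℕ} (hF : Fintype.card F = p ^ h) (hh : 0 < h)
    {ι : Type*} [Fintype ι] (P : ι → MvPolynomial σ 𝕎) (d : ι → ℕ) {D E μ : ℕ}
    (hdD : ∀ i, d i ≤ D) (hD : 1 ≤ D) (hdeg : ∀ i, (P i).totalDegree ≤ d i)
    (hE : 0 < E) (hEdvd : p ^ h - 1 ∣ E) (hEdigits : (Nat.digits p E).sum ≤ h * (p - 1))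
    (hμ : μ = 0 ∨ D * (μ - 1) + ∑ i, d i + 1 ≤ Fintype.card σ) :
    (p : 𝕎) ^ (h * μ) ∣
      ∑ x : σ → F, ∏ i, MvPolynomial.eval (fun v => τ (x v)) (P i) ^ E := by
  classical
  simp_rw [MvPolynomial.eval_eq', sum_pow_eq_sum_piAntidiag, prod_univ_sum]
  rw [sum_comm]
  refine dvd_sum fun κ hκ => ?_
  have hκ (i : ι) : ∑ u ∈ (P i).support, κ i u = E :=
    (mem_piAntidiag.1 (Fintype.mem_piFinset.1 hκ i)).1
  have hfactor (x : σ → F) :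
      ∏ i, ((Nat.multinomial (P i).support (κ i) : 𝕎) *
        ∏ u ∈ (P i).support, ((P i).coeff u * ∏ v, τ (x v) ^ u v) ^ κ i u) =
      (∏ i, ∏ u ∈ (P i).support, (P i).coeff u ^ κ i u) *
        ((∏ i, Nat.multinomial (P i).support (κ i) : ℕ) : 𝕎) *
        ∏ v, τ (x v) ^ ∑ i, ∑ u ∈ (P i).support, κ i u * u v := by
    have hmono : ∏ v, τ (x v) ^ ∑ i, ∑ u ∈ (P i).support, κ i u * u v =
        ∏ i, ∏ u ∈ (P i).support, (∏ v, τ (x v) ^ u v) ^ κ i u := by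
      simp_rw [← prod_pow_eq_pow_sum, ← prod_pow, ← pow_mul]
      rw [prod_comm]
      refine prod_congr rfl fun i _ => ?_
      rw [prod_comm]
      simp_rw [mul_comm]
    rw [hmono, Nat.cast_prod, ← prod_mul_distrib, ← prod_mul_distrib]
    refine prod_congr rfl fun i _ => ?_
    simp_rw [mul_pow]
    rw [prod_mul_distrib]
    ring
  simp_rw [hfactor]
  rw [← mul_sum, ← Fintype.piFinset_univ, ← prod_univ_sum (fun _ => univ)
    (fun v a => τ a ^ ∑ i, ∑ u ∈ (P i).support, κ i u * u v), mul_assoc]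
  refine Dvd.dvd.mul_left ?_ _
  by_cases hexp : ∀ v, p ^ h - 1 ∣ ∑ i, ∑ u ∈ (P i).support, κ i u * u v
  · have hnat := pow_dvd_prod_multinomial_mul_pow hh (fun i => (P i).support) (fun u v => u v) κ d
      hdD hD (fun i u hu => by
        refine le_trans ?_ (hdeg i)
        simpa [Finsupp.sum_fintype] using MvPolynomial.le_totalDegree hu)
      hκ hE hEdvd hEdigits hμ hexp
    have hcast := Nat.cast_dvd_cast (α := 𝕎) hnat
    rw [Nat.cast_mul, Nat.cast_pow] at hcast
    refine hcast.trans (mul_dvd_mul_left _ ?_)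
    rw [Nat.cast_pow, ← prod_const]
    refine (prod_dvd_prod_of_dvd _ _ fun v hv => ?_).trans
      (prod_dvd_prod_of_subset _ _ _ (filter_subset _ univ))
    rw [(mem_filter.1 hv).2]
    simp [hF]
  · push Not at hexp
    obtain ⟨v, hv⟩ := hexp
    rw [prod_eq_zero (mem_univ v) (sum_teichmuller_pow_eq_zero (by rwa [hF])), mul_zero]
    exact dvd_zero _

open Classical in
theorem pow_dvd_one_sub_pow_sub_ite {h : ℕ} (hF : Fintype.card F = p ^ h) (hh : 0 < h)
    (L : ℕ) (y : 𝕎) :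
    (p : 𝕎) ^ L ∣ (1 - y ^ ((p ^ h - 1) * p ^ L)) - if (p : 𝕎) ∣ y then 1 else 0 := by
  have hp : 1 < p := (Fact.out : p.Prime).one_lt
  split_ifs with hy
  · rw [sub_sub_cancel_left, dvd_neg]
    have hL : L ≤ (p ^ h - 1) * p ^ L := (Nat.lt_pow_self hp).le.trans
      (Nat.le_mul_of_pos_left _ (Nat.sub_pos_of_lt (Nat.one_lt_pow hh.ne' hp)))
    exact (pow_dvd_pow _ hL).trans (pow_dvd_pow_of_dvd hy _)
  · rw [sub_zero, ← dvd_neg, neg_sub]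
    have hone : (p : 𝕎) ∣ y ^ (p ^ h - 1) - 1 := by
      rw [← constantCoeff_eq_zero_iff_dvd] at hy ⊢
      rw [map_sub, map_pow, map_one, ← hF, FiniteField.pow_card_sub_one_eq_one _ hy, sub_self]
    have := dvd_sub_pow_of_dvd_sub hone L
    rw [one_pow, ← pow_mul] at this
    exact (pow_dvd_pow _ L.le_succ).trans this

open Classical in
/-- The Ax–Katz theorem, for a system of congruences modulo `p` over the Teichmüller box. -/
theorem pow_dvd_card_filter_forall_dvd_eval {h : ℕ} (hF : Fintype.card F = p ^ h) (hh : 0 < h)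
    {ι : Type*} [Fintype ι] (P : ι → MvPolynomial σ 𝕎) (d : ι → ℕ) {D μ : ℕ}
    (hdD : ∀ i, d i ≤ D) (hD : 1 ≤ D) (hdeg : ∀ i, (P i).totalDegree ≤ d i)
    (hμ : μ = 0 ∨ D * (μ - 1) + ∑ i, d i + 1 ≤ Fintype.card σ) :
    (p ^ h) ^ μ ∣
      #{x : σ → F | ∀ i, (p : 𝕎) ∣ MvPolynomial.eval (fun v => τ (x v)) (P i)} := by
  have hp : 1 < p := (Fact.out : p.Prime).one_lt
  have hQ : 0 < p ^ h - 1 := Nat.sub_pos_of_lt (Nat.one_lt_pow hh.ne' hp)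
  rw [← pow_mul]
  apply pow_dvd_of_pow_dvd_natCast (F := F)
  set L := h * μ with hL
  set E := (p ^ h - 1) * p ^ L with hE
  have hEdigits : (Nat.digits p E).sum ≤ h * (p - 1) := by
    rw [hE, mul_comm, Nat.digits_base_pow_mul hp hQ, List.sum_append, List.sum_replicate, smul_zero,
      zero_add]
    refine (List.sum_le_card_nsmul _ (p - 1) fun c hc => ?_).trans ?_
    · exact Nat.le_sub_one_of_lt (Nat.digits_lt_base hp hc)
    · rw [smul_eq_mul]
      exact Nat.mul_le_mul_right _ ((Nat.digits_length_le_iff hp _).2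
        (Nat.sub_lt (by positivity) one_pos))
  rw [← Ideal.Quotient.eq_zero_iff_dvd, natCast_card_filter, map_sum]
  have hite (x : σ → F) : Ideal.Quotient.mk (Ideal.span {(p : 𝕎) ^ L})
      (if ∀ i, (p : 𝕎) ∣ MvPolynomial.eval (fun v => τ (x v)) (P i) then 1 else 0) =
      Ideal.Quotient.mk (Ideal.span {(p : 𝕎) ^ L})
        (∏ i, (1 + -MvPolynomial.eval (fun v => τ (x v)) (P i) ^ E)) := by
    have hprod : (if ∀ i, (p : 𝕎) ∣ MvPolynomial.eval (fun v => τ (x v)) (P i) then 1 else 0) =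
        ∏ i, if (p : 𝕎) ∣ MvPolynomial.eval (fun v => τ (x v)) (P i) then (1 : 𝕎) else 0 := by
      rw [Fintype.prod_ite_zero, prod_const_one]
    rw [hprod, map_prod, map_prod]
    refine prod_congr rfl fun i _ => Eq.symm ?_
    rw [Ideal.Quotient.eq, Ideal.mem_span_singleton, ← sub_eq_add_neg]
    exact pow_dvd_one_sub_pow_sub_ite hF hh L _
  rw [sum_congr rfl fun x _ => hite x, ← map_sum, Ideal.Quotient.eq_zero_iff_dvd]
  simp_rw [prod_one_add]
  rw [sum_comm]
  refine dvd_sum fun S _ => ?_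
  simp_rw [prod_neg]
  rw [← mul_sum]
  refine Dvd.dvd.mul_left ?_ _
  simp_rw [← prod_coe_sort S]
  refine pow_dvd_sum_prod_eval_pow hF hh (fun i : S => P i) (fun i => d i) (fun i => hdD i) hD
    (fun i => hdeg i) (by positivity) (dvd_mul_right _ _) hEdigits (hμ.imp_right fun hμ => ?_)
  have : ∑ i : S, d i ≤ ∑ i, d i := by
    rw [sum_coe_sort S]
    exact sum_le_sum_of_subset (subset_univ S)
  omega

theorem pow_dvd_frobenius_iff {k : ℕ} {a : 𝕎} : (p : 𝕎) ^ k ∣ frobenius a ↔ (p : 𝕎) ^ k ∣ a := by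
  have hmap : frobeniusEquiv p F ((p : 𝕎) ^ k) = (p : 𝕎) ^ k := by simp
  conv_lhs => rw [← hmap]
  exact map_dvd_iff (frobeniusEquiv p F)

theorem pow_succ_dvd_iff_of_p_mul_eq {y z : 𝕎} (hyz : (p : 𝕎) * z = frobenius y - y ^ p) (m : ℕ) :
    (p : 𝕎) ^ (m + 1) ∣ y ↔ (p : 𝕎) ∣ y ∧ (p : 𝕎) ^ m ∣ z := by
  by_cases hy : (p : 𝕎) ∣ y
  swap
  · exact iff_of_false (fun hdvd => hy ((dvd_pow_self _ m.succ_ne_zero).trans hdvd))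
      fun hdvd => hy hdvd.1
  have hp : 1 < p := (Fact.out : p.Prime).one_lt
  obtain ⟨a, rfl⟩ := hy
  have hz : z = frobenius a - p ^ (p - 1) * a ^ p := by
    refine mul_left_cancel₀ (p_nonzero p F) ?_
    rw [hyz, map_mul, map_natCast, mul_pow, mul_sub, ← mul_assoc, mul_pow_sub_one (by omega)]
  rw [pow_succ', mul_dvd_mul_iff_left (p_nonzero p F), and_iff_right (dvd_mul_right _ _), hz]
  refine ⟨fun ha => dvd_sub (pow_dvd_frobenius_iff.2 ha)
    ((ha.trans (dvd_pow_self a (by omega))).mul_left _), fun hdvd => ?_⟩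
  suffices ∀ j ≤ m, (p : 𝕎) ^ j ∣ a from this m le_rfl
  intro j
  induction j with
  | zero => simp
  | succ j ih =>
    intro hj
    have hpow : (p : 𝕎) ^ (j + 1) ∣ p ^ (p - 1) * a ^ p := by
      rw [pow_succ']
      exact mul_dvd_mul (dvd_pow_self _ (by omega))
        ((ih (by omega)).trans (dvd_pow_self a (by omega)))
    exact pow_dvd_frobenius_iff.1 ((dvd_sub_left hpow).1 ((pow_dvd_pow _ hj).trans hdvd))

/-- The polynomial `g = (f ^ φ (X ^ p) - f(X) ^ p) / p`, where `φ` is the Frobenius on coefficients. -/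
theorem exists_p_mul_eval_eq_frobenius_sub_pow {σ : Type*} (f : MvPolynomial σ 𝕎) :
    ∃ g : MvPolynomial σ 𝕎, g.totalDegree ≤ f.totalDegree * p ∧
      ∀ x : σ → F, (p : 𝕎) * MvPolynomial.eval (fun v => τ (x v)) g =
        frobenius (MvPolynomial.eval (fun v => τ (x v)) f) -
          MvPolynomial.eval (fun v => τ (x v)) f ^ p := by
  obtain ⟨g, hg⟩ : MvPolynomial.C (p : 𝕎) ∣
      MvPolynomial.map frobenius (MvPolynomial.expand p f) - f ^ p := by
    rw [MvPolynomial.C_dvd_iff_map_hom_eq_zero constantCoeff _ constantCoeff_eq_zero_iff_dvd]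
    have hcomp : (constantCoeff : 𝕎 →+* F).comp frobenius =
        (_root_.frobenius F p).comp constantCoeff :=
      RingHom.ext fun a => coeff_frobenius_charP p a 0
    rw [map_sub, MvPolynomial.map_map, hcomp, ← MvPolynomial.map_map, MvPolynomial.map_expand,
      MvPolynomial.map_frobenius_expand, map_pow, sub_self]
  refine ⟨g, ?_, fun x => ?_⟩
  · rcases eq_or_ne g 0 with rfl | hg0
    · simp
    have hdeg := MvPolynomial.totalDegree_mul_of_isDomain
      (MvPolynomial.C_ne_zero.2 (p_nonzero p F)) hg0
    rw [MvPolynomial.totalDegree_C, zero_add, ← hg] at hdeg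
    rw [← hdeg]
    refine (MvPolynomial.totalDegree_sub _ _).trans (max_le ?_ ?_)
    · rw [← MvPolynomial.totalDegree_expand]
      exact MvPolynomial.totalDegree_le_of_support_subset (MvPolynomial.support_map_subset _ _)
    · rw [mul_comm]
      exact MvPolynomial.totalDegree_pow _ _
  · have heval := congrArg (MvPolynomial.eval fun v => τ (x v)) hg
    have hτ : frobenius ∘ (fun v => τ (x v)) = (fun v => τ (x v)) ^ p := by
      funext v
      simp [frobenius_eq_map_frobenius, _root_.frobenius_def]
    rw [map_sub, map_pow, map_mul, MvPolynomial.eval_C, MvPolynomial.eval_map,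
      MvPolynomial.eval₂_expand, ← hτ, ← MvPolynomial.eval₂_comp] at heval
    exact heval.symm

/-- Over the Teichmüller box, a congruence modulo `p ^ m` is equivalent to a system of `m`
congruences modulo `p`. -/
theorem exists_pow_dvd_eval_iff_forall_dvd {σ : Type*} (m : ℕ) (f : MvPolynomial σ 𝕎) :
    ∃ P : Fin m → MvPolynomial σ 𝕎, (∀ s, (P s).totalDegree ≤ f.totalDegree * p ^ (s : ℕ)) ∧
      ∀ x : σ → F, (p : 𝕎) ^ m ∣ MvPolynomial.eval (fun v => τ (x v)) f ↔
        ∀ s, (p : 𝕎) ∣ MvPolynomial.eval (fun v => τ (x v)) (P s) := by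
  induction m generalizing f with
  | zero => exact ⟨Fin.elim0, fun s => s.elim0, by simp⟩
  | succ m ih =>
    obtain ⟨g, hgdeg, hg⟩ := exists_p_mul_eval_eq_frobenius_sub_pow f
    obtain ⟨P, hPdeg, hP⟩ := ih g
    refine ⟨Fin.cons f P, fun s => ?_, fun x => ?_⟩
    · refine Fin.cases (by simp) (fun s => ?_) s
      rw [Fin.cons_succ, Fin.val_succ, pow_succ', ← mul_assoc]
      exact (hPdeg s).trans (Nat.mul_le_mul_right _ hgdeg)
    · rw [pow_succ_dvd_iff_of_p_mul_eq (hg x), hP, Fin.forall_fin_succ]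
      simp

end WittVector

theorem toNat_max_zero_ceil_eq_zero_or {p n d m : ℕ} (hp : 1 < p) (hd : 1 ≤ d) :
    let μ := (max 0 ⌈((n : ℚ) - d * ((p : ℚ) ^ m - 1) / ((p : ℚ) - 1)) /
        (d * (p : ℚ) ^ (m - 1))⌉).toNat
    μ = 0 ∨ d * p ^ (m - 1) * (μ - 1) + ∑ s : Fin m, d * p ^ (s : ℕ) + 1 ≤ n := by
  intro μ
  refine or_iff_not_imp_left.2 fun hμ => ?_
  obtain ⟨k, hk⟩ := Nat.exists_eq_succ_of_ne_zero hμ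
  have hgeom : ((∑ s : Fin m, d * p ^ (s : ℕ) : ℕ) : ℚ) =
      d * ((p : ℚ) ^ m - 1) / ((p : ℚ) - 1) := by
    have hp1 : (p : ℚ) ≠ 1 := by exact_mod_cast hp.ne'
    rw [Fin.sum_univ_eq_sum_range (fun s => d * p ^ s), ← mul_sum, Nat.cast_mul, Nat.cast_sum,
      mul_div_assoc, ← geom_sum_eq hp1]
    simp
  have hlt : (k : ℤ) < ⌈((n : ℚ) - d * ((p : ℚ) ^ m - 1) / ((p : ℚ) - 1)) /
      (d * (p : ℚ) ^ (m - 1))⌉ := by omega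
  have hD : (0 : ℚ) < d * (p : ℚ) ^ (m - 1) := by positivity
  rw [Int.lt_ceil, lt_div_iff₀ hD, ← hgeom, lt_sub_iff_add_lt] at hlt
  rw [hk, Nat.succ_sub_one, Nat.add_one_le_iff, mul_comm]
  exact_mod_cast hlt

/-- Weak version for a single polynomial over the Teichmüller box: for `f ∈ ℤ_q[x_1,…,x_n]`
nonzero of degree `d ≥ 1` (with `ℤ_q` modeled as Witt vectors over `F = 𝔽_q`) and
`V = {X ∈ T_q^n : p^m ∣ f(X)}`, one has `ord_q |V| ≥ ⌈(n − d(p^m−1)/(p−1))/(d·p^(m−1))⌉*`,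
i.e. `q^⌈…⌉* ∣ |V|`. -/
theorem stmt12 (p h n : ℕ) [Fact p.Prime] (hh : 0 < h) (hn : 0 < n)
    (F : Type) [Field F] [Fintype F] [CharP F p] (hF : Fintype.card F = p ^ h)
    (f : MvPolynomial (Fin n) (WittVector p F)) (hf : f ≠ 0)
    (d : ℕ) (hd : f.totalDegree = d) (hd1 : 1 ≤ d) (m : ℕ) (hm : 1 ≤ m) :
    (p ^ h) ^ (max 0 ⌈((n : ℚ) - d * ((p : ℚ) ^ m - 1) / ((p : ℚ) - 1)) /
        (d * (p : ℚ) ^ (m - 1))⌉).toNat ∣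
      {X : Fin n → WittVector p F |
        (∀ i, X i ∈ Set.range (WittVector.teichmuller p (R := F))) ∧
        (p : WittVector p F) ^ m ∣ MvPolynomial.eval X f}.ncard := by
  have hp : 1 < p := (Fact.out : p.Prime).one_lt
  subst hd
  obtain ⟨P, hPdeg, hP⟩ := WittVector.exists_pow_dvd_eval_iff_forall_dvd m f
  classical
  have hcard := WittVector.pow_dvd_card_filter_forall_dvd_eval hF hh P
    (fun s => f.totalDegree * p ^ (s : ℕ)) (D := f.totalDegree * p ^ (m - 1))
    (fun s => Nat.mul_le_mul_left _ (Nat.pow_le_pow_right (by omega) (by omega)))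
    (Nat.mul_pos hd1 (by positivity)) hPdeg
    (by
      rw [Fintype.card_fin]
      exact toNat_max_zero_ceil_eq_zero_or hp hd1)
  convert hcard using 1
  rw [← Set.ncard_coe_finset, ← Set.ncard_image_of_injective _
    (WittVector.teichmuller_injective (p := p) (F := F)).comp_left]
  congr 1
  ext X
  simp only [Set.mem_ofPred_eq, Set.mem_image, coe_filter, mem_univ, true_and]
  constructor
  · rintro ⟨hX, hdvd⟩
    choose x hx using hX
    obtain rfl : (fun v => WittVector.teichmuller p (x v)) = X := funext hx
    exact ⟨x, (hP x).1 hdvd, rfl⟩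
  · rintro ⟨x, hx, rfl⟩
    exact ⟨fun i => ⟨x i, rfl⟩, (hP x).2 hx⟩
end

section
/- Let p be prime, m ≥ 1, and f ∈ ℤ_p[x_1, …, x_n] nonzero with Teichmüller expansion f = Σ_{i≥0} p^i f_i. Let d ≥ 1 and suppose deg(f_i) ≤ d·p^i for all i ∈ [0, m−1]. Let V = {X ∈ T_p^n : f(X) ≡ 0 (mod p^m)}, where T_p = {0} ∪ {(p−1)-th roots of unity in ℤ_p}. Then ord_p(|V|) ≥ ⌈(n − d·(p^m − 1)/(p − 1)) / (d·p^(m−1))⌉*. -/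
open Finset

/-- The ideal generated by the `p ^ a * T ^ b` of weighted order at least `r`, where `T` has weight
`d` and `p` has weight `d * φ`. -/
def weightIdeal {A : Type*} [CommRing A] (p φ d : ℕ) (T : A) (r : ℕ) : Ideal A :=
  Ideal.span {x | ∃ a b : ℕ, r ≤ d * (a * φ + b) ∧ x = (p : A) ^ a * T ^ b}

section WeightIdeal

variable {A : Type*} [CommRing A] {p φ d : ℕ} {T : A}

lemma weightIdeal_antitone : Antitone (weightIdeal p φ d T) := by
  intro r s hrs
  apply Ideal.span_mono
  rintro x ⟨a, b, h, rfl⟩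
  exact ⟨a, b, hrs.trans h, rfl⟩

lemma mem_weightIdeal_zero (x : A) : x ∈ weightIdeal p φ d T 0 := by
  have h : (1 : A) ∈ weightIdeal p φ d T 0 := Ideal.subset_span ⟨0, 0, by simp, by simp⟩
  simpa using Ideal.mul_mem_left _ x h

lemma natCast_mem_weightIdeal : (p : A) ∈ weightIdeal p φ d T (d * φ) :=
  Ideal.subset_span ⟨1, 0, by simp, by simp⟩

lemma self_mem_weightIdeal : T ∈ weightIdeal p φ d T d :=
  Ideal.subset_span ⟨0, 1, by simp, by simp⟩

lemma mul_mem_weightIdeal {r s : ℕ} {x y : A} (hx : x ∈ weightIdeal p φ d T r)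
    (hy : y ∈ weightIdeal p φ d T s) : x * y ∈ weightIdeal p φ d T (r + s) := by
  have h := Ideal.mul_mem_mul hx hy
  unfold weightIdeal at h
  rw [Ideal.span_mul_span'] at h
  refine Ideal.span_mono ?_ h
  rintro _ ⟨_, ⟨a, b, h₁, rfl⟩, _, ⟨a', b', h₂, rfl⟩, rfl⟩
  exact ⟨a + a', b + b', by linarith, by ring⟩

lemma pow_mem_weightIdeal {r : ℕ} {x : A} (hx : x ∈ weightIdeal p φ d T r) (k : ℕ) :
    x ^ k ∈ weightIdeal p φ d T (k * r) := by
  induction k with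
  | zero => simpa using mem_weightIdeal_zero _
  | succ k ih =>
    rw [pow_succ, add_mul, one_mul]
    exact mul_mem_weightIdeal ih hx

/-- The elements `g ^ p ^ i - 1` have the weight of `(g - 1) ^ p ^ i`. -/
lemma pow_prime_pow_sub_one_mem_weightIdeal (hp : p.Prime) {g : A} {k : ℕ} :
    ∀ i ≤ k + 1, g ^ p ^ i - 1 ∈ weightIdeal p (p ^ k * (p - 1)) d (g - 1) (d * p ^ i) := by
  intro i
  induction i with
  | zero => intro _; simpa using self_mem_weightIdeal
  | succ i ih =>
    intro hi
    have ih := ih (by omega)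
    obtain ⟨r, hr⟩ := (Commute.all (g ^ p ^ i - 1) 1).exists_add_pow_prime_pow_eq hp 1
    have key : g ^ p ^ (i + 1) - 1 =
        (g ^ p ^ i - 1) ^ p + r * ((p : A) * (g ^ p ^ i - 1)) := by
      rw [pow_succ, pow_mul]
      simp only [pow_one, sub_add_cancel, one_pow, mul_one] at hr
      rw [hr]; ring
    rw [key]
    refine Ideal.add_mem _ ?_ (Ideal.mul_mem_left _ _ ?_)
    · have := pow_mem_weightIdeal ih p
      rwa [show p * (d * p ^ i) = d * p ^ (i + 1) by ring] at this
    · refine weightIdeal_antitone ?_ (mul_mem_weightIdeal natCast_mem_weightIdeal ih)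
      rw [← mul_add]
      refine Nat.mul_le_mul_left _ ?_
      have h1 : p ^ i ≤ p ^ k := Nat.pow_le_pow_right hp.pos (by omega)
      have h2 := hp.one_le
      calc p ^ (i + 1) = p ^ i * (p - 1) + p ^ i := by
            rw [pow_succ, ← Nat.mul_succ]; congr 1; omega
        _ ≤ _ := by gcongr

/-- Fleck–Weisman: high powers of `g - 1` are divisible by powers of `p` if
`g ^ p ^ (k + 1) = 1`. -/
lemma prime_pow_dvd_sub_one_pow (hp : p.Prime) {g : A} {k : ℕ} (hg : g ^ p ^ (k + 1) = 1) (e : ℕ) :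
    (p : A) ^ e ∣ (g - 1) ^ (p ^ k + e * (p ^ k * (p - 1))) := by
  set T := g - 1 with hT
  set u := g ^ p ^ k - 1 with hu
  obtain ⟨r, hr⟩ : ∃ r, u = T ^ p ^ k + p * r := by
    obtain ⟨r, hr⟩ := (Commute.all T 1).exists_add_pow_prime_pow_eq hp k
    refine ⟨T * r, ?_⟩
    rw [hu, show g = T + 1 by rw [hT]; ring, hr]; ring
  obtain ⟨s, hs⟩ : ∃ s, u ^ p = p * (u * s) := by
    obtain ⟨s, hs⟩ := (Commute.all u 1).exists_add_pow_prime_pow_eq hp 1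
    refine ⟨-s, ?_⟩
    simp only [hu, pow_one, sub_add_cancel, one_pow, mul_one, ← pow_mul, ← pow_succ, hg] at hs
    rw [← hu] at hs
    linear_combination -hs
  obtain ⟨t, ht⟩ : ∃ t, T ^ (p ^ k * (p - 1)) = u ^ (p - 1) + p * t := by
    obtain ⟨t, ht⟩ := sub_dvd_pow_sub_pow (T ^ p ^ k) u (p - 1)
    refine ⟨-(r * t), ?_⟩
    rw [pow_mul]
    have : T ^ p ^ k - u = - (p * r) := by rw [hr]; ring
    rw [this] at ht
    linear_combination ht
  have huT : u * T ^ (p ^ k * (p - 1)) = p * (u * (s + t)) := by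
    rw [ht, mul_add, ← pow_succ', Nat.sub_add_cancel hp.one_le, hs]; ring
  have huTe : ∀ e, u * T ^ (e * (p ^ k * (p - 1))) = p ^ e * (u * (s + t) ^ e) := by
    intro e
    induction e with
    | zero => simp
    | succ e ih =>
      rw [add_mul, one_mul, pow_add]
      calc _ = (u * T ^ (e * (p ^ k * (p - 1)))) * T ^ (p ^ k * (p - 1)) := by ring
        _ = p ^ e * (s + t) ^ e * (u * T ^ (p ^ k * (p - 1))) := by rw [ih]; ring
        _ = _ := by rw [huT]; ring
  induction e with
  | zero => simp
  | succ e ih =>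
    have h1 : T ^ (p ^ k + (e + 1) * (p ^ k * (p - 1))) =
        u * T ^ ((e + 1) * (p ^ k * (p - 1))) - p * r * T ^ ((e + 1) * (p ^ k * (p - 1))) := by
      rw [pow_add, hr]; ring
    rw [h1, huTe]
    refine dvd_sub (dvd_mul_right _ _) ?_
    rw [pow_succ', mul_assoc]
    refine mul_dvd_mul_left _ (Dvd.dvd.mul_left (ih.trans (pow_dvd_pow _ ?_)) _)
    have : p ^ k * 1 ≤ p ^ k * (p - 1) := Nat.mul_le_mul_left _ (by have := hp.two_le; omega)
    linarith

lemma weightIdeal_le_span_prime_pow (hp : p.Prime) {g : A} {k r e : ℕ}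
    (hg : g ^ p ^ (k + 1) = 1)
    (hr : ∀ w, r ≤ d * w → p ^ k + e * (p ^ k * (p - 1)) ≤ w) :
    weightIdeal p (p ^ k * (p - 1)) d (g - 1) r ≤ Ideal.span {(p : A) ^ e} := by
  refine Ideal.span_le.2 ?_
  rintro _ ⟨a, b, h, rfl⟩
  rw [SetLike.mem_coe, Ideal.mem_span_singleton]
  have h' := hr _ h
  rcases le_total e a with hea | hea
  · exact Dvd.dvd.mul_right (pow_dvd_pow _ hea) _
  · obtain ⟨c, rfl⟩ := Nat.exists_eq_add_of_le hea
    rw [pow_add]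
    refine mul_dvd_mul_left _ ((prime_pow_dvd_sub_one_pow hp hg c).trans (pow_dvd_pow _ ?_))
    linarith

/-- Polynomials whose coefficient at `e` has weight at least the degree of `e`. -/
def weightedPolys {σ : Type*} (F : ℕ → Ideal A) : Set (MvPolynomial σ A) :=
  {Q | ∀ e, Q.coeff e ∈ F e.degree}

lemma prod_mem_weightedPolys {σ ι : Type*} (s : Finset ι) (Q : ι → MvPolynomial σ A)
    (h : ∀ i ∈ s, Q i ∈ weightedPolys (weightIdeal p φ d T)) :
    ∏ i ∈ s, Q i ∈ weightedPolys (σ := σ) (weightIdeal p φ d T) := by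
  classical
  refine Finset.prod_induction _ (· ∈ weightedPolys (weightIdeal p φ d T)) ?_ ?_ h
  · intro a b ha hb e
    rw [MvPolynomial.coeff_mul]
    refine Ideal.sum_mem _ fun x hx ↦ ?_
    rw [← mem_antidiagonal.1 hx, map_add]
    exact mul_mem_weightIdeal (ha _) (hb _)
  · intro e
    rw [MvPolynomial.coeff_one]
    split_ifs with h
    · subst h; simpa using mem_weightIdeal_zero _
    · exact Ideal.zero_mem _

/-- Substituting a monomial of degree at most `w` into a one-variable polynomial whose `k`-th
coefficient has weight at least `k * w`. -/
lemma eval₂_monomial_mem_weightedPolys {σ : Type*} {w : ℕ} {q : Polynomial A}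
    (hq : ∀ k, q.coeff k ∈ weightIdeal p φ d T (k * w)) {e : σ →₀ ℕ} (he : e.degree ≤ w) (c : A) :
    q.eval₂ MvPolynomial.C (MvPolynomial.monomial e c) ∈
      weightedPolys (weightIdeal p φ d T) := by
  classical
  intro e'
  rw [Polynomial.eval₂_eq_sum_range, MvPolynomial.coeff_sum]
  refine Ideal.sum_mem _ fun k _ ↦ ?_
  rw [MvPolynomial.coeff_C_mul, MvPolynomial.monomial_pow, MvPolynomial.coeff_monomial]
  split_ifs with h
  · subst h
    refine Ideal.mul_mem_right _ _ (weightIdeal_antitone ?_ (hq k))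
    rw [map_nsmul, smul_eq_mul]
    exact Nat.mul_le_mul_left _ he
  · simp

end WeightIdeal

section Teichmuller

variable {p : ℕ} [Fact p.Prime]

local notation "τ" => WittVector.teichmuller p (R := ZMod p)
local notation "W" => WittVector p (ZMod p)

lemma isUnit_wittVector_of_constantCoeff_ne_zero {x : W}
    (hx : WittVector.constantCoeff x ≠ 0) : IsUnit x :=
  WittVector.isUnit_of_coeff_zero_ne_zero x hx

lemma prime_dvd_wittVector_iff {x : W} :
    (p : W) ∣ x ↔ WittVector.constantCoeff x = 0 := by
  rw [← Ideal.mem_span_singleton, WittVector.mem_span_p_iff_coeff_zero_eq_zero]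
  rfl

lemma constantCoeff_teichmuller (a : ZMod p) : WittVector.constantCoeff (τ a) = a :=
  WittVector.teichmuller_coeff_zero p a

lemma isUnit_teichmuller_sub {a b : ZMod p} (h : a ≠ b) : IsUnit (τ a - τ b) := by
  apply isUnit_wittVector_of_constantCoeff_ne_zero
  rw [map_sub, constantCoeff_teichmuller, constantCoeff_teichmuller]
  exact sub_ne_zero.2 h

lemma toZModPow_eq_zero_iff (m : ℕ) (x : W) :
    WittVector.toZModPow p m x = 0 ↔ (p : W) ^ m ∣ x := by
  rw [← Ideal.mem_span_singleton, WittVector.mem_span_p_pow_iff_le_coeff_eq_zero,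
    ← WittVector.mem_ker_truncate, RingHom.mem_ker]
  simp [WittVector.toZModPow]

lemma exists_natCast_sub_dvd (m : ℕ) (x : W) : ∃ N : ℕ, (p : W) ^ m ∣ x - N := by
  refine ⟨(WittVector.toZModPow p m x).val, ?_⟩
  rw [← toZModPow_eq_zero_iff, map_sub, map_natCast, ZMod.natCast_zmod_val, sub_self]

/-- Power sums of Teichmüller representatives vanish in small positive degree. -/
lemma sum_teichmuller_pow_eq_zero {k : ℕ} (hk : 0 < k) (hkp : k < p - 1) :
    ∑ a : ZMod p, (τ a) ^ k = 0 := by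
  obtain ⟨b, hb⟩ : ∃ b : (ZMod p)ˣ, b ^ k ≠ 1 := by
    by_contra! h
    rw [FiniteField.forall_pow_eq_one_iff, ZMod.card] at h
    exact absurd (Nat.le_of_dvd hk h) (by omega)
  have h1 : τ ((b : ZMod p) ^ k) * ∑ a : ZMod p, (τ a) ^ k = ∑ a : ZMod p, (τ a) ^ k := by
    rw [Finset.mul_sum, ← Equiv.sum_comp (Units.mulLeft b) (fun a ↦ (τ a) ^ k)]
    refine Finset.sum_congr rfl fun a _ ↦ ?_
    rw [Units.mulLeft_apply, map_mul, mul_pow, map_pow]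
  have h2 : IsUnit (τ ((b : ZMod p) ^ k) - τ 1) :=
    isUnit_teichmuller_sub fun h ↦ hb (Units.ext (by simpa using h))
  refine (h2.mul_right_eq_zero).1 ?_
  rw [sub_mul, h1, map_one, one_mul, sub_self]

/-- Lagrange basis polynomials at the Teichmüller representatives. -/
lemma exists_lagrange_teichmuller (b : ZMod p) :
    ∃ L : Polynomial W, L.natDegree ≤ p - 1 ∧ ∀ a, L.eval (τ a) = if a = b then 1 else 0 := by
  classical
  refine ⟨∏ s ∈ univ.erase b, Polynomial.C (Ring.inverse (τ b - τ s)) *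
    (Polynomial.X - Polynomial.C (τ s)), ?_, fun a ↦ ?_⟩
  · refine (Polynomial.natDegree_prod_le _ _).trans ?_
    refine (Finset.sum_le_card_nsmul _ _ 1 fun s _ ↦ ?_).trans ?_
    · exact (Polynomial.natDegree_C_mul_le _ _).trans (Polynomial.natDegree_X_sub_C_le _)
    · simp [ZMod.card]
  · rw [Polynomial.eval_prod]
    split_ifs with h
    · subst h
      refine Finset.prod_eq_one fun s hs ↦ ?_
      simp [Ring.inverse_mul_cancel _ (isUnit_teichmuller_sub (ne_of_mem_erase hs).symm)]
    · exact Finset.prod_eq_zero (mem_erase.2 ⟨h, mem_univ a⟩) (by simp)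

lemma exists_interpolation_teichmuller {A : Type*} [CommRing A] [Algebra W A] (I : Ideal A)
    (h : ZMod p → A) (hI : ∀ a, h a ∈ I) :
    ∃ q : Polynomial A, q.natDegree ≤ p - 1 ∧ (∀ j, q.coeff j ∈ I) ∧
      ∀ a, q.eval (algebraMap W A (τ a)) = h a := by
  choose L hLdeg hL using exists_lagrange_teichmuller (p := p)
  refine ⟨∑ b, Polynomial.C (h b) * (L b).map (algebraMap W A), ?_, fun j ↦ ?_, fun a ↦ ?_⟩
  · refine Polynomial.natDegree_sum_le_of_forall_le _ _ fun b _ ↦ ?_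
    exact (Polynomial.natDegree_C_mul_le _ _).trans
      ((Polynomial.natDegree_map_le).trans (hLdeg b))
  · rw [Polynomial.finsetSum_coeff]
    refine Ideal.sum_mem _ fun b _ ↦ ?_
    rw [Polynomial.coeff_C_mul]
    exact Ideal.mul_mem_right _ _ (hI b)
  · simp [Polynomial.eval_finsetSum, Polynomial.aeval_algebraMap_apply_eq_algebraMap_eval, hL]

/-- Binomial coefficients modulo `p` as polynomials in Teichmüller representatives. -/
lemma exists_choose_poly_teichmuller {j : ℕ} (hj : j < p) :
    ∃ B : Polynomial W, B.natDegree ≤ j ∧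
      ∀ a : ZMod p, (p : W) ∣ (a.val.choose j : W) - B.eval (τ a) := by
  have hp : p.Prime := Fact.out
  have hu : IsUnit ((j.factorial : ℕ) : W) := by
    apply isUnit_wittVector_of_constantCoeff_ne_zero
    rw [map_natCast, Ne, ZMod.natCast_eq_zero_iff, hp.dvd_factorial]
    omega
  refine ⟨Polynomial.C (Ring.inverse ((j.factorial : ℕ) : W)) * descPochhammer W j, ?_,
    fun a ↦ ?_⟩
  · exact (Polynomial.natDegree_C_mul_le _ _).trans (descPochhammer_natDegree _ _).le
  · have h1 : ((a.val.choose j : ℕ) : W) =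
        Ring.inverse ((j.factorial : ℕ) : W) * (descPochhammer W j).eval ((a.val : ℕ) : W) := by
      rw [descPochhammer_eval_eq_descFactorial, Nat.descFactorial_eq_factorial_mul_choose,
        Nat.cast_mul, Ring.inverse_mul_cancel_left _ _ hu]
    rw [h1, Polynomial.eval_mul, Polynomial.eval_C, ← mul_sub]
    refine Dvd.dvd.mul_left (Dvd.dvd.trans ?_ (Polynomial.sub_dvd_eval_sub _ _ _)) _
    rw [prime_dvd_wittVector_iff, map_sub, map_natCast, constantCoeff_teichmuller,
      ZMod.natCast_zmod_val, sub_self]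

lemma addChar_prime_pow_mul_natCast {A : Type*} [CommRing A] {ψ : AddChar W A} (i N : ℕ) :
    ψ ((p : W) ^ i * N) = (ψ 1 ^ p ^ i) ^ N := by
  rw [← pow_mul, ← AddChar.map_nsmul_eq_pow]
  congr 1
  simp

lemma addChar_sub_one_mem_weightIdeal {A : Type*} [CommRing A] {ψ : AddChar W A} {k : ℕ}
    (d : ℕ) (hψ : ∀ x, ψ ((p : W) ^ (k + 1) * x) = 1) {i : ℕ} (hi : i ≤ k + 1) (x : W) :
    ψ ((p : W) ^ i * x) - 1 ∈ weightIdeal p (p ^ k * (p - 1)) d (ψ 1 - 1) (d * p ^ i) := by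
  obtain ⟨N, y, hy⟩ := exists_natCast_sub_dvd (k + 1) x
  have hx : (p : W) ^ i * x = (p : W) ^ i * N + (p : W) ^ (k + 1) * ((p : W) ^ i * y) := by
    linear_combination (p : W) ^ i * hy
  rw [hx, AddChar.map_add_eq_mul, hψ, mul_one, addChar_prime_pow_mul_natCast]
  refine Ideal.mem_of_dvd _ ?_ (pow_prime_pow_sub_one_mem_weightIdeal Fact.out i hi)
  simpa using sub_dvd_pow_sub_pow (ψ 1 ^ p ^ i) 1 N

/-- On Teichmüller representatives an additive character trivial on `p ^ (k + 1)` is a polynomial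
whose coefficients have large weight. -/
lemma exists_poly_eq_addChar_teichmuller {A : Type*} [CommRing A] [Algebra W A]
    {ψ : AddChar W A} {k : ℕ} (d : ℕ) (hψ : ∀ x, ψ ((p : W) ^ (k + 1) * x) = 1) {i : ℕ} (hi : i ≤ k) :
    ∃ q : Polynomial A,
      (∀ j, q.coeff j ∈ weightIdeal p (p ^ k * (p - 1)) d (ψ 1 - 1) (j * (d * p ^ i))) ∧
      ∀ a, q.eval (algebraMap W A (τ a)) = ψ ((p : W) ^ i * τ a) := by
  have hp : p.Prime := Fact.out
  set F := weightIdeal p (p ^ k * (p - 1)) d (ψ 1 - 1) with hF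
  set T := ψ 1 ^ p ^ i - 1 with hT
  have hTF : T ∈ F (d * p ^ i) := pow_prime_pow_sub_one_mem_weightIdeal hp i (by omega)
  have hB : ∀ j, ∃ B : Polynomial W, B.natDegree ≤ j ∧ (j < p →
      ∀ a : ZMod p, (p : W) ∣ (a.val.choose j : W) - B.eval (τ a)) ∧ (j = 0 → B = 1) := by
    intro j
    rcases Nat.eq_zero_or_pos j with rfl | hj
    · exact ⟨1, by simp⟩
    by_cases hjp : j < p
    · obtain ⟨B, h1, h2⟩ := exists_choose_poly_teichmuller hjp
      exact ⟨B, h1, fun _ ↦ h2, fun h ↦ by omega⟩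
    · exact ⟨0, by simp, fun h ↦ absurd h hjp, fun h ↦ by omega⟩
  choose B hBdeg hBp hB0 using hB
  set q₀ : Polynomial A :=
    ∑ j ∈ range p, Polynomial.C (T ^ j) * (B j).map (algebraMap W A) with hq₀
  have hq₀F : ∀ l, q₀.coeff l ∈ F (l * (d * p ^ i)) := by
    intro l
    rw [hq₀, Polynomial.finsetSum_coeff]
    refine Ideal.sum_mem _ fun j _ ↦ ?_
    rw [Polynomial.coeff_C_mul]
    rcases le_or_gt l j with hlj | hlj
    · refine Ideal.mul_mem_right _ _ (weightIdeal_antitone ?_ (pow_mem_weightIdeal hTF j))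
      exact Nat.mul_le_mul_right _ hlj
    · rw [Polynomial.coeff_map, Polynomial.coeff_eq_zero_of_natDegree_lt
        ((hBdeg j).trans_lt hlj)]
      simp
  have hrem : ∀ a, ψ ((p : W) ^ i * τ a) - q₀.eval (algebraMap W A (τ a)) ∈
      F (d * p ^ (i + 1)) := by
    intro a
    obtain ⟨s, hs⟩ : (p : W) ∣ τ a - (a.val : ℕ) := by
      rw [prime_dvd_wittVector_iff, map_sub, map_natCast, constantCoeff_teichmuller,
        ZMod.natCast_zmod_val, sub_self]
    have hψa : ψ ((p : W) ^ i * τ a) = (T + 1) ^ a.val * ψ ((p : W) ^ (i + 1) * s) := by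
      rw [show (p : W) ^ i * τ a = (p : W) ^ i * (a.val : ℕ) + (p : W) ^ (i + 1) * s by
        linear_combination (p : W) ^ i * hs, AddChar.map_add_eq_mul,
        addChar_prime_pow_mul_natCast, hT, sub_add_cancel]
    have hbin : (T + 1) ^ a.val = ∑ j ∈ range p, T ^ j * algebraMap W A (a.val.choose j : ℕ) := by
      rw [add_pow]
      refine Finset.sum_subset_zero_on_sdiff ?_ ?_ ?_
      · intro j hj
        have := a.val_lt
        simp only [mem_range] at hj ⊢
        omega
      · intro j hj
        simp only [mem_sdiff, mem_range] at hj
        rw [Nat.choose_eq_zero_of_lt (by omega)]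
        simp
      · simp
    have hsplit : ψ ((p : W) ^ i * τ a) - q₀.eval (algebraMap W A (τ a)) =
        (T + 1) ^ a.val * (ψ ((p : W) ^ (i + 1) * s) - 1) +
          ∑ j ∈ range p, T ^ j *
            algebraMap W A ((a.val.choose j : W) - (B j).eval (τ a)) := by
      simp only [map_sub, mul_sub, Finset.sum_sub_distrib, ← hbin]
      rw [hψa, hq₀, Polynomial.eval_finsetSum]
      simp [Polynomial.aeval_algebraMap_apply_eq_algebraMap_eval]
    rw [hsplit]
    refine Ideal.add_mem _ (Ideal.mul_mem_left _ _
      (addChar_sub_one_mem_weightIdeal d hψ (by omega) s)) (Ideal.sum_mem _ fun j hj ↦ ?_)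
    rcases Nat.eq_zero_or_pos j with rfl | hj0
    · simp [hB0 0 rfl]
    obtain ⟨c, hc⟩ := hBp j (mem_range.1 hj) a
    rw [hc, map_mul, map_natCast, ← mul_assoc]
    refine Ideal.mul_mem_right _ _ (weightIdeal_antitone ?_
      (mul_mem_weightIdeal (pow_mem_weightIdeal hTF j) natCast_mem_weightIdeal))
    have h1 : p ^ i ≤ p ^ k := Nat.pow_le_pow_right hp.pos hi
    have h2 := hp.one_le
    calc d * p ^ (i + 1) = 1 * (d * p ^ i) + d * (p ^ i * (p - 1)) := by
          obtain ⟨r, rfl⟩ := Nat.exists_eq_add_of_le h2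
          rw [Nat.add_sub_cancel_left]; ring
      _ ≤ _ := by gcongr; omega
  obtain ⟨q₁, hq₁deg, hq₁F, hq₁⟩ := exists_interpolation_teichmuller _ _ hrem
  refine ⟨q₀ + q₁, fun l ↦ ?_, fun a ↦ ?_⟩
  · rw [Polynomial.coeff_add]
    refine Ideal.add_mem _ (hq₀F l) ?_
    rcases le_or_gt l (p - 1) with hl | hl
    · refine weightIdeal_antitone ?_ (hq₁F l)
      calc l * (d * p ^ i) ≤ p * (d * p ^ i) := Nat.mul_le_mul_right _ (by omega)
        _ = _ := by ring
    · rw [Polynomial.coeff_eq_zero_of_natDegree_lt (hq₁deg.trans_lt hl)]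
      exact Ideal.zero_mem _
  · rw [Polynomial.eval_add, hq₁]
    ring

/-- Summing over the Teichmüller box gains weight `p - 1` for every variable. -/
lemma sum_eval_teichmuller_mem_weightIdeal {A : Type*} [CommRing A] [Algebra W A] {n φ d : ℕ}
    {T : A} (hφ : p - 1 ≤ d * φ) {Q : MvPolynomial (Fin n) A}
    (hQ : Q ∈ weightedPolys (weightIdeal p φ d T)) :
    ∑ a : Fin n → ZMod p, MvPolynomial.eval (fun v ↦ algebraMap W A (τ (a v))) Q ∈
      weightIdeal p φ d T (n * (p - 1)) := by
  classical
  have step : ∀ (r k : ℕ) (y : A), y ∈ weightIdeal p φ d T (r + k) →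
      y * algebraMap W A (∑ t : ZMod p, τ t ^ k) ∈ weightIdeal p φ d T (r + (p - 1)) := by
    intro r k y hy
    rcases Nat.eq_zero_or_pos k with rfl | hk
    · have : algebraMap W A (∑ t : ZMod p, τ t ^ 0) = p := by simp [ZMod.card]
      rw [this]
      exact weightIdeal_antitone (by omega) (mul_mem_weightIdeal hy natCast_mem_weightIdeal)
    rcases lt_or_ge k (p - 1) with hkp | hkp
    · rw [sum_teichmuller_pow_eq_zero hk hkp]; simp
    · exact Ideal.mul_mem_right _ _ (weightIdeal_antitone (by omega) hy)
  have steps : ∀ (s : Finset (Fin n)) (e : Fin n → ℕ) (r : ℕ) (y : A),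
      y ∈ weightIdeal p φ d T (r + ∑ v ∈ s, e v) →
      y * ∏ v ∈ s, algebraMap W A (∑ t : ZMod p, τ t ^ e v) ∈
        weightIdeal p φ d T (r + #s * (p - 1)) := by
    intro s e
    induction s using Finset.induction_on with
    | empty => intro r y hy; simpa using hy
    | insert v s hv ih =>
      intro r y hy
      rw [Finset.sum_insert hv, ← add_assoc, add_right_comm] at hy
      have hy' := step (r + ∑ v ∈ s, e v) (e v) y hy
      rw [add_right_comm] at hy'
      have := ih (r + (p - 1)) _ hy'
      rw [Finset.prod_insert hv, Finset.card_insert_of_notMem hv, ← mul_assoc]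
      rwa [show r + (#s + 1) * (p - 1) = r + (p - 1) + #s * (p - 1) by ring]
  simp only [MvPolynomial.eval_eq']
  rw [Finset.sum_comm]
  refine Ideal.sum_mem _ fun e _ ↦ ?_
  have hprod : ∑ a : Fin n → ZMod p, Q.coeff e * ∏ v, algebraMap W A (τ (a v)) ^ e v =
      Q.coeff e * ∏ v, algebraMap W A (∑ t : ZMod p, τ t ^ e v) := by
    rw [← Finset.mul_sum]
    congr 1
    simp only [map_sum, map_pow]
    rw [Finset.prod_univ_sum, Fintype.piFinset_univ]
  rw [hprod]
  have := steps univ e 0 (Q.coeff e) (by simpa [Finsupp.degree_eq_sum] using hQ e)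
  simpa using this

/-- The values of an additive character at the values of a polynomial on the Teichmüller box. -/
lemma sum_addChar_eval_mem_weightIdeal {A : Type*} [CommRing A] [Algebra W A] {ψ : AddChar W A}
    {n k d : ℕ} (hd : 1 ≤ d) (hψ : ∀ x, ψ ((p : W) ^ (k + 1) * x) = 1)
    (g : ℕ → MvPolynomial (Fin n) W) (hgT : ∀ i e, (g i).coeff e ∈ Set.range τ)
    (hdeg : ∀ i < k + 1, (g i).totalDegree ≤ d * p ^ i) :
    ∑ a : Fin n → ZMod p, ψ (∑ i ∈ range (k + 1),
        (p : W) ^ i * MvPolynomial.eval (fun v ↦ τ (a v)) (g i)) ∈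
      weightIdeal p (p ^ k * (p - 1)) d (ψ 1 - 1) (n * (p - 1)) := by
  have hp : p.Prime := Fact.out
  choose c hc using hgT
  have hq : ∀ i, ∃ q : Polynomial A, i ≤ k →
      (∀ j, q.coeff j ∈ weightIdeal p (p ^ k * (p - 1)) d (ψ 1 - 1) (j * (d * p ^ i))) ∧
      ∀ a, q.eval (algebraMap W A (τ a)) = ψ ((p : W) ^ i * τ a) := by
    intro i
    by_cases hi : i ≤ k
    · obtain ⟨q, h⟩ := exists_poly_eq_addChar_teichmuller d hψ hi
      exact ⟨q, fun _ ↦ h⟩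
    · exact ⟨0, fun h ↦ absurd h hi⟩
  choose q hq using hq
  set Q : MvPolynomial (Fin n) A := ∏ i ∈ range (k + 1), ∏ e ∈ (g i).support,
    (q i).eval₂ MvPolynomial.C (MvPolynomial.monomial e (algebraMap W A (τ (c i e)))) with hQ
  have hQmem : Q ∈ weightedPolys (weightIdeal p (p ^ k * (p - 1)) d (ψ 1 - 1)) := by
    refine prod_mem_weightedPolys _ _ fun i hi ↦ prod_mem_weightedPolys _ _ fun e he ↦ ?_
    have hi' := mem_range.1 hi
    refine eval₂_monomial_mem_weightedPolys (hq i (by omega)).1 ?_ _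
    refine le_trans ?_ (hdeg i hi')
    rw [Finsupp.degree_apply]
    exact MvPolynomial.le_totalDegree he
  have hQeval : ∀ a : Fin n → ZMod p,
      MvPolynomial.eval (fun v ↦ algebraMap W A (τ (a v))) Q = ψ (∑ i ∈ range (k + 1),
        (p : W) ^ i * MvPolynomial.eval (fun v ↦ τ (a v)) (g i)) := by
    intro a
    have hsum : ∀ (ι : Type) (s : Finset ι) (x : ι → W), ψ (∑ i ∈ s, x i) = ∏ i ∈ s, ψ (x i) := by
      intro ι s x
      exact map_prod ψ.toMonoidHom (fun i ↦ Multiplicative.ofAdd (x i)) s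
    rw [hQ, map_prod, hsum]
    refine Finset.prod_congr rfl fun i hi ↦ ?_
    rw [map_prod, MvPolynomial.eval_eq', Finset.mul_sum, hsum]
    refine Finset.prod_congr rfl fun e _ ↦ ?_
    rw [Polynomial.hom_eval₂, MvPolynomial.eval_monomial, Finsupp.prod_fintype _ _ (by simp)]
    have hmon : (g i).coeff e * ∏ v, τ (a v) ^ e v = τ (c i e * ∏ v, a v ^ e v) := by
      rw [map_mul, hc, map_prod]
      simp only [map_pow]
    rw [hmon, ← (hq i (by have := mem_range.1 hi; omega)).2]
    have hcomp : (MvPolynomial.eval fun v ↦ algebraMap W A (τ (a v))).comp MvPolynomial.C =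
        RingHom.id A := by ext; simp
    rw [hcomp, Polynomial.eval, map_mul, map_prod]
    simp only [map_mul, map_prod, map_pow]
  have := sum_eval_teichmuller_mem_weightIdeal (p := p) (n := n) (T := ψ 1 - 1) (d := d)
    (φ := p ^ k * (p - 1)) ?_ hQmem
  · simpa only [hQeval] using this
  · rw [← mul_assoc]
    exact Nat.le_mul_of_pos_left _ (Nat.mul_pos hd (pow_pos hp.pos _))

end Teichmuller

lemma prime_pow_dvd_natCast_wittVector_iff {p : ℕ} [Fact p.Prime] (e N : ℕ) :
    (p : WittVector p (ZMod p)) ^ e ∣ (N : WittVector p (ZMod p)) ↔ p ^ e ∣ N := by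
  rw [← toZModPow_eq_zero_iff, map_natCast, ZMod.natCast_eq_zero_iff]

/-- The group-ring valued additive character `x ↦ [x mod p ^ m]`. -/
noncomputable def groupRingAddChar (p m : ℕ) [Fact p.Prime] :
    AddChar (WittVector p (ZMod p)) (AddMonoidAlgebra (WittVector p (ZMod p)) (ZMod (p ^ m))) where
  toFun x := AddMonoidAlgebra.single (WittVector.toZModPow p m x) 1
  map_zero_eq_one' := by rw [map_zero, AddMonoidAlgebra.one_def]
  map_add_eq_mul' x y := by rw [map_add, AddMonoidAlgebra.single_mul_single, mul_one]

lemma groupRingAddChar_apply (p m : ℕ) [Fact p.Prime] (x : WittVector p (ZMod p)) :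
    groupRingAddChar p m x = AddMonoidAlgebra.single (WittVector.toZModPow p m x) 1 := rfl

lemma groupRingAddChar_eq_one (p m : ℕ) [Fact p.Prime] (x : WittVector p (ZMod p)) :
    groupRingAddChar p m ((p : WittVector p (ZMod p)) ^ m * x) = 1 := by
  rw [groupRingAddChar_apply, (toZModPow_eq_zero_iff m _).2 (dvd_mul_right _ _),
    AddMonoidAlgebra.one_def]

lemma dvd_coeff_of_natCast_dvd {R M : Type*} [CommRing R] [AddCommMonoid M] {N : ℕ}
    {x : AddMonoidAlgebra R M} (h : (N : AddMonoidAlgebra R M) ∣ x) (y : M) :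
    (N : R) ∣ x.coeff y := by
  obtain ⟨z, rfl⟩ := h
  rw [← nsmul_eq_mul, AddMonoidAlgebra.coeff_smul_apply, nsmul_eq_mul]
  exact dvd_mul_right _ _

lemma weight_bound_of_ceil_pos {p n k d : ℕ} (hp : p.Prime) (hd : 1 ≤ d) {e : ℕ}
    (he : (e : ℤ) = ⌈((n : ℚ) - d * ((p : ℚ) ^ (k + 1) - 1) / ((p : ℚ) - 1)) /
      (d * (p : ℚ) ^ k)⌉) (w : ℕ) (hw : n * (p - 1) ≤ d * w) :
    p ^ k + e * (p ^ k * (p - 1)) ≤ w := by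
  have h1 := Int.ceil_lt_add_one (((n : ℚ) - d * ((p : ℚ) ^ (k + 1) - 1) / ((p : ℚ) - 1)) /
      (d * (p : ℚ) ^ k))
  rw [← he, Int.cast_natCast, ← sub_lt_iff_lt_add] at h1
  have hp1 : (0 : ℚ) < (p : ℚ) - 1 := sub_pos.2 (by exact_mod_cast hp.one_lt)
  have hp0 : (0 : ℚ) < p := by exact_mod_cast hp.pos
  have hd0 : (0 : ℚ) < d := by exact_mod_cast hd
  rw [lt_div_iff₀ (by positivity), lt_sub_iff_add_lt, ← lt_sub_iff_add_lt', div_lt_iff₀ hp1] at h1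
  have hw' : (n : ℚ) * (p - 1) ≤ d * w := by
    have := hw
    rw [← Nat.cast_le (α := ℚ)] at this
    push_cast [hp.one_le] at this
    exact this
  have h2 : (d : ℚ) * (p ^ k + e * (p ^ k * (p - 1))) < d * (w + 1) := by
    rw [pow_succ] at h1
    nlinarith
  have h3 := lt_of_mul_lt_mul_left h2 hd0.le
  rw [← Nat.lt_succ_iff, ← Nat.cast_lt (α := ℚ)]
  push_cast [hp.one_le]
  exact h3

/-- Strong version over `ℤ_p` (modeled as Witt vectors over `ZMod p`) for the Teichmüller
box: if `f` has Teichmüller expansion `f = Σ_i p^i f_i` (given coefficientwise) with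
`deg f_i ≤ d·p^i` for `i < m`, then `p^⌈(n − d(p^m−1)/(p−1))/(d·p^(m−1))⌉* ∣ |V|` where
`V = {X ∈ T_p^n : p^m ∣ f(X)}`. -/
theorem stmt14 (p n m d : ℕ) [Fact p.Prime] (hm : 1 ≤ m) (hd : 1 ≤ d)
    (f : MvPolynomial (Fin n) (WittVector p (ZMod p))) (hf : f ≠ 0)
    (g : ℕ → MvPolynomial (Fin n) (WittVector p (ZMod p)))
    (hgT : ∀ i dd, MvPolynomial.coeff dd (g i) ∈
      Set.range (WittVector.teichmuller p (R := ZMod p)))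
    (hgf : ∀ M : ℕ, ∀ dd, (p : WittVector p (ZMod p)) ^ M ∣
      MvPolynomial.coeff dd f -
        ∑ i ∈ Finset.range M, (p : WittVector p (ZMod p)) ^ i * MvPolynomial.coeff dd (g i))
    (hdeg : ∀ i < m, (g i).totalDegree ≤ d * p ^ i) :
    p ^ (max 0 ⌈((n : ℚ) - d * ((p : ℚ) ^ m - 1) / ((p : ℚ) - 1)) /
        (d * (p : ℚ) ^ (m - 1))⌉).toNat ∣
      {X : Fin n → WittVector p (ZMod p) |
        (∀ i, X i ∈ Set.range (WittVector.teichmuller p (R := ZMod p))) ∧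
        (p : WittVector p (ZMod p)) ^ m ∣ MvPolynomial.eval X f}.ncard := by
  classical
  have hp : p.Prime := Fact.out
  obtain ⟨k, rfl⟩ := Nat.exists_eq_add_of_le' hm
  rw [Nat.add_sub_cancel]
  generalize hz : ⌈((n : ℚ) - d * ((p : ℚ) ^ (k + 1) - 1) / ((p : ℚ) - 1)) /
        (d * (p : ℚ) ^ k)⌉ = z
  rcases le_or_gt z 0 with hz0 | hz0
  · simp [max_eq_left hz0]
  rw [max_eq_right hz0.le]
  lift z to ℕ using hz0.le
  rw [Int.toNat_natCast]
  set ψ := groupRingAddChar p (k + 1) with hψ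
  have hg : ψ 1 ^ p ^ (k + 1) = 1 := by
    rw [← AddChar.map_nsmul_eq_pow, nsmul_eq_mul]
    simpa using groupRingAddChar_eq_one p (k + 1) 1
  have hfg : ∀ X, ψ (MvPolynomial.eval X f) = ψ (∑ i ∈ range (k + 1),
      (p : WittVector p (ZMod p)) ^ i * MvPolynomial.eval X (g i)) := by
    intro X
    obtain ⟨h, hh⟩ : MvPolynomial.C ((p : WittVector p (ZMod p)) ^ (k + 1)) ∣
        f - ∑ i ∈ range (k + 1), MvPolynomial.C ((p : WittVector p (ZMod p)) ^ i) * g i := by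
      rw [MvPolynomial.C_dvd_iff_dvd_coeff]
      intro e
      simpa only [MvPolynomial.coeff_sub, MvPolynomial.coeff_sum, MvPolynomial.coeff_C_mul]
        using hgf (k + 1) e
    have := congrArg (MvPolynomial.eval X) (sub_eq_iff_eq_add.1 hh)
    simp only [map_add, map_mul, map_sum, MvPolynomial.eval_C] at this
    rw [this, AddChar.map_add_eq_mul, groupRingAddChar_eq_one, one_mul]
  have hmem := sum_addChar_eval_mem_weightIdeal hd (groupRingAddChar_eq_one p (k + 1)) g hgT hdeg
  have hdvd := Ideal.mem_span_singleton.1 (weightIdeal_le_span_prime_pow hp hg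
    (weight_bound_of_ceil_pos hp hd hz.symm) hmem)
  rw [← Nat.cast_pow] at hdvd
  have hcoeff := dvd_coeff_of_natCast_dvd hdvd 0
  rw [← prime_pow_dvd_natCast_wittVector_iff, ← Nat.cast_pow]
  convert hcoeff using 1
  set V : Finset (Fin n → ZMod p) := {a | (p : WittVector p (ZMod p)) ^ (k + 1) ∣
    MvPolynomial.eval (fun v ↦ WittVector.teichmuller p (a v)) f} with hV
  have hinj : Function.Injective fun (a : Fin n → ZMod p) (v : Fin n) ↦
      WittVector.teichmuller p (a v) := by
    intro a b hab
    funext v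
    simpa [constantCoeff_teichmuller] using
      congrArg WittVector.constantCoeff (congrFun hab v)
  have hcard : {X : Fin n → WittVector p (ZMod p) |
        (∀ i, X i ∈ Set.range (WittVector.teichmuller p (R := ZMod p))) ∧
        (p : WittVector p (ZMod p)) ^ (k + 1) ∣ MvPolynomial.eval X f}.ncard = #V := by
    rw [← Finset.card_image_of_injective V hinj, ← Set.ncard_coe_finset]
    congr 1
    ext X
    simp only [Set.mem_ofPred_eq, coe_image, Set.mem_image, mem_coe, hV, mem_filter, mem_univ,
      true_and]
    constructor
    · rintro ⟨h1, h2⟩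
      choose a ha using h1
      obtain rfl : (fun v ↦ WittVector.teichmuller p (a v)) = X := funext ha
      exact ⟨a, h2, rfl⟩
    · rintro ⟨a, h2, rfl⟩
      exact ⟨fun i ↦ ⟨a i, rfl⟩, h2⟩
  rw [hcard, AddMonoidAlgebra.coeff_sum, Finsupp.finsetSum_apply, hV,
    Finset.natCast_card_filter]
  refine Finset.sum_congr rfl fun a _ ↦ ?_
  rw [← hψ, ← hfg, hψ, groupRingAddChar_apply, AddMonoidAlgebra.coeff_single, Finsupp.single_apply]
  simp only [toZModPow_eq_zero_iff]
end

section
/- Let p be prime, m_1, …, m_s ≥ 1, and let 𝓑 = I_1 × ⋯ × I_n where each I_j ⊆ ℤ_p is a complete system of residues modulo p. Let f_1, …, f_s ∈ ℤ_p[x_1, …, x_n] be nonzero and V = {X ∈ 𝓑 : f_k(X) ≡ 0 (mod p^{m_k}) for all k ∈ [1,s]}. Then ord_p(|V|) ≥ ⌈(n − Σ_k ((p^{m_k}−1)/(p−1))·deg f_k) / max_k (p^{m_k−1}·deg f_k)⌉*, where ⌈t⌉* is the least nonnegative integer ≥ t. -/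
open Finset

/-- Gregory–Newton expansion of an integer-valued polynomial. -/
theorem exists_newton_expansion (P : Polynomial ℚ) (F : ℕ → ℤ)
    (hF : ∀ y : ℕ, (F y : ℚ) = P.eval (y : ℚ)) :
    ∃ c : ℕ → ℤ, (∀ y, F y = ∑ i ∈ range (P.natDegree + 1), c i * (y.choose i : ℤ)) ∧
      (c P.natDegree : ℚ) = P.leadingCoeff * P.natDegree.factorial := by
  have hcast : ∀ i, (((fwdDiff 1)^[i] F 0 : ℤ) : ℚ) = (fwdDiff 1)^[i] P.eval 0 := by
    intro i
    rw [fwdDiff_iter_eq_sum_shift, fwdDiff_iter_eq_sum_shift]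
    push_cast [zsmul_eq_mul]
    refine sum_congr rfl fun k _ => ?_
    rw [hF]
    simp
  have hzero : ∀ i, P.natDegree < i → (fwdDiff 1)^[i] F 0 = 0 := by
    intro i hi
    have h := hcast i
    rw [Polynomial.fwdDiff_iter_eq_zero_of_degree_lt hi, Pi.zero_apply] at h
    exact_mod_cast h
  refine ⟨fun i => (fwdDiff 1)^[i] F 0, fun y => ?_, ?_⟩
  · have h := shift_eq_sum_fwdDiff_iter 1 F y 0
    simp only [zero_add, smul_eq_mul, mul_one, nsmul_eq_mul] at h
    have key : ∀ N, y ≤ N → F y = ∑ i ∈ range (N + 1), (y.choose i : ℤ) * (fwdDiff 1)^[i] F 0 := by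
      intro N hN
      rw [h]
      refine sum_subset (range_mono (by omega)) fun i _ hi => ?_
      rw [mem_range, not_lt] at hi
      rw [Nat.choose_eq_zero_of_lt (by omega)]
      simp
    rw [key (max y P.natDegree) (le_max_left _ _)]
    symm
    simp_rw [mul_comm]
    refine sum_subset (range_mono (by omega)) fun i _ hi => ?_
    rw [mem_range, not_lt] at hi
    rw [hzero i (by omega), mul_zero]
  · rw [hcast, Polynomial.fwdDiff_iter_degree_eq_factorial]
    simp

theorem dvd_pow_prime_sub_self (p : ℕ) (hp : p.Prime) (y : ℕ) : p ∣ y ^ p - y := by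
  have : Fact p.Prime := ⟨hp⟩
  rw [← CharP.cast_eq_zero_iff (ZMod p) p, Nat.cast_sub (Nat.le_self_pow hp.ne_zero y)]
  simp

/-- `y ^ r * ((y ^ p - y) / p).choose q` is a `ℤ`-combination of binomial coefficients in `y` whose
top coefficient is prime to `p`. -/
theorem exists_choose_expansion (p : ℕ) (hp : p.Prime) (q r : ℕ) (hr : r < p) :
    ∃ c : ℕ → ℤ, (∀ y : ℕ, (y : ℤ) ^ r * (((y ^ p - y) / p).choose q : ℤ) =
      ∑ i ∈ range (p * q + r + 1), c i * (y.choose i : ℤ)) ∧ ¬ (p : ℤ) ∣ c (p * q + r) := by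
  have hp0 : (p : ℚ) ≠ 0 := by exact_mod_cast hp.ne_zero
  have hp1 := hp.one_lt
  set D : Polynomial ℚ := Polynomial.C (p : ℚ)⁻¹ * (Polynomial.X ^ p - Polynomial.X) with hD
  have hXdeg : (Polynomial.X ^ p - Polynomial.X : Polynomial ℚ).natDegree = p :=
    FiniteField.X_pow_card_sub_X_natDegree_eq ℚ hp1
  have hDdeg : D.natDegree = p := by
    rw [hD, Polynomial.natDegree_C_mul (inv_ne_zero hp0), hXdeg]
  have hDlead : D.leadingCoeff = (p : ℚ)⁻¹ := by
    rw [hD, Polynomial.leadingCoeff_mul, Polynomial.leadingCoeff_C,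
      Polynomial.leadingCoeff_sub_of_degree_lt, Polynomial.leadingCoeff_X_pow, mul_one]
    rw [Polynomial.degree_X_pow, Polynomial.degree_X]
    exact_mod_cast hp1
  set P : Polynomial ℚ := Polynomial.X ^ r *
    (Polynomial.C (q.factorial : ℚ)⁻¹ * (descPochhammer ℚ q).comp D) with hP
  have hq0 : (q.factorial : ℚ) ≠ 0 := by exact_mod_cast q.factorial_ne_zero
  have hcompne : (descPochhammer ℚ q).comp D ≠ 0 := by
    rw [← Polynomial.leadingCoeff_ne_zero,
      Polynomial.leadingCoeff_comp (by rw [hDdeg]; exact hp.ne_zero), hDlead,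
      (monic_descPochhammer ℚ q).leadingCoeff]
    simp [hp0]
  have hPdeg : P.natDegree = p * q + r := by
    rw [hP, Polynomial.natDegree_X_pow_mul, Polynomial.natDegree_C_mul (inv_ne_zero hq0),
      Polynomial.natDegree_comp, hDdeg, descPochhammer_natDegree, mul_comm]
    simp [hcompne, hq0]
  have hPlead : P.leadingCoeff = (q.factorial : ℚ)⁻¹ * ((p : ℚ)⁻¹) ^ q := by
    rw [hP, Polynomial.leadingCoeff_mul, Polynomial.leadingCoeff_mul,
      Polynomial.leadingCoeff_comp (by rw [hDdeg]; exact hp.ne_zero),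
      hDlead, (monic_descPochhammer ℚ q).leadingCoeff, descPochhammer_natDegree]
    simp
  obtain ⟨c, hc, hctop⟩ := exists_newton_expansion P
    (fun y => (y : ℤ) ^ r * (((y ^ p - y) / p).choose q : ℤ)) (by
      intro y
      have hy : D.eval (y : ℚ) = (((y ^ p - y) / p : ℕ) : ℚ) := by
        rw [Nat.cast_div (dvd_pow_prime_sub_self p hp y) hp0,
          Nat.cast_sub (Nat.le_self_pow hp.ne_zero y), hD]
        simp
        field_simp
      simp only [hP, Polynomial.eval_mul, Polynomial.eval_pow, Polynomial.eval_X,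
        Polynomial.eval_C, Polynomial.eval_comp, hy, descPochhammer_eval_eq_descFactorial]
      push_cast
      rw [Nat.descFactorial_eq_factorial_mul_choose]
      push_cast
      field_simp)
  refine ⟨c, by rwa [hPdeg] at hc, ?_⟩
  rw [hPdeg, hPlead] at hctop
  have hfac : c (p * q + r) * (p ^ q * q.factorial : ℤ) = ((p * q + r).factorial : ℤ) := by
    have : (c (p * q + r) : ℚ) * (p ^ q * q.factorial) = ((p * q + r).factorial : ℚ) := by
      rw [hctop, inv_pow]; field_simp
    exact_mod_cast this
  rintro ⟨e, he⟩
  have : Fact p.Prime := ⟨hp⟩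
  have hdvd : p ^ (q + 1) * q.factorial ∣ (p * q + r).factorial := by
    rw [← Int.natCast_dvd_natCast]
    exact ⟨e, by rw [← hfac, he]; push_cast; ring⟩
  have hpow : p ^ (q + 1 + padicValNat p q.factorial) ∣ (p * q + r).factorial := by
    rw [pow_add]
    exact (mul_dvd_mul_left _ pow_padicValNat_dvd).trans hdvd
  have hval := (padicValNat_dvd_iff_le (Nat.factorial_ne_zero (p * q + r))).1 hpow
  rw [padicValNat_factorial_mul_add _ hr, padicValNat_factorial_mul] at hval
  omega

/-- If `(1 + T) ^ p ^ (k + 1) = 1`, then powers of `T` are highly divisible by `p`. -/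
theorem pow_dvd_pow_of_one_add_pow_eq_one {A : Type*} [CommRing A] (p : ℕ) (hp : p.Prime) (k : ℕ)
    (T : A) (hT : (1 + T) ^ p ^ (k + 1) = 1) (a : ℕ) :
    (p : A) ^ a ∣ T ^ (p ^ k + a * (p ^ k * (p - 1))) := by
  obtain ⟨V, hV⟩ := exists_add_pow_prime_pow_eq hp 1 T k
  set Y : A := (1 + T) ^ p ^ k - 1 with hY
  have hTY : T ^ p ^ k = Y - p * (T * V) := by
    rw [hY, hV]; ring
  obtain ⟨H, hH⟩ := exists_add_pow_prime_eq hp 1 Y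
  have hYp : Y ^ p = -(p * Y * H) := by
    have h1 : (1 + Y) ^ p = 1 := by
      rw [hY, add_sub_cancel, ← pow_mul, ← pow_succ, hT]
    rw [h1] at hH
    linear_combination -hH
  obtain ⟨U, hU⟩ : (p : A) ∣ (T ^ p ^ k) ^ (p - 1) - Y ^ (p - 1) :=
    (Dvd.intro (-(T * V)) (by rw [hTY]; ring)).trans (sub_dvd_pow_sub_pow (T ^ p ^ k) Y (p - 1))
  have hYT : Y * T ^ (p ^ k * (p - 1)) = p * (Y * (U - H)) := by
    have h2 : Y * Y ^ (p - 1) = -(p * Y * H) := by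
      rw [← hYp, ← pow_succ', Nat.sub_add_cancel hp.one_le]
    rw [pow_mul]
    linear_combination Y * hU + h2
  have hYTa : ∀ a : ℕ, Y * T ^ (a * (p ^ k * (p - 1))) = p ^ a * (Y * (U - H) ^ a) := by
    intro a
    induction a with
    | zero => simp
    | succ a ih =>
      rw [add_one_mul, pow_add, ← mul_assoc, ih]
      linear_combination (p : A) ^ a * (U - H) ^ a * hYT
  induction a with
  | zero => simp
  | succ a ih =>
    rw [pow_add T, hTY, sub_mul, hYTa]
    refine dvd_sub (dvd_mul_right _ _) ?_
    have hle : p ^ k + a * (p ^ k * (p - 1)) ≤ (a + 1) * (p ^ k * (p - 1)) := by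
      have h1 : 1 ≤ p - 1 := by have := hp.two_le; omega
      have h2 : p ^ k * 1 ≤ p ^ k * (p - 1) := Nat.mul_le_mul_left _ h1
      rw [add_one_mul]
      omega
    rw [pow_succ', mul_assoc]
    refine mul_dvd_mul_left _ ?_
    exact Dvd.dvd.mul_left (ih.trans (pow_dvd_pow T hle)) _

/-- The indicator function of `p ^ (k + 1) ∣ y` as a combination of binomial coefficients with
highly divisible coefficients. -/
theorem exists_indicator_expansion (R : Type*) [CommRing R] (p : ℕ) (hp : p.Prime) (k : ℕ) :
    ∃ c : ℕ → R, (∀ y J : ℕ, y < J →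
      (if p ^ (k + 1) ∣ y then (1 : R) else 0) = ∑ j ∈ range J, c j * (y.choose j : R)) ∧
      ∀ j a : ℕ, p ^ k + a * (p ^ k * (p - 1)) ≤ j → (p : R) ^ a ∣ c j := by
  set T : AddMonoidAlgebra R (ZMod (p ^ (k + 1))) := AddMonoidAlgebra.single 1 1 - 1 with hT
  have hpow : ∀ y : ℕ, (1 + T) ^ y = AddMonoidAlgebra.single (y : ZMod (p ^ (k + 1))) 1 := by
    intro y
    rw [hT, add_sub_cancel, AddMonoidAlgebra.single_pow]
    simp
  let ev : AddMonoidAlgebra R (ZMod (p ^ (k + 1))) →+ R :=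
    (Finsupp.applyAddHom 0).comp AddMonoidAlgebra.coeffAddEquiv.toAddMonoidHom
  have hev : ∀ y : ℕ, ev (AddMonoidAlgebra.single (y : ZMod (p ^ (k + 1))) 1) =
      if p ^ (k + 1) ∣ y then (1 : R) else 0 := by
    intro y
    change (Finsupp.single (y : ZMod (p ^ (k + 1))) (1 : R)) 0 = _
    rw [Finsupp.single_apply]
    simp only [ZMod.natCast_eq_zero_iff]
  refine ⟨fun j => ev (T ^ j), fun y J hy => ?_, fun j a hj => ?_⟩
  · rw [← hev, ← hpow, add_comm 1 T, add_pow, map_sum]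
    simp only [one_pow, mul_one, ← nsmul_eq_mul', map_nsmul]
    refine sum_subset (range_mono hy) fun i _ hi => ?_
    rw [mem_range, not_lt] at hi
    rw [Nat.choose_eq_zero_of_lt (by omega), zero_nsmul]
  · have hT1 : (1 + T) ^ p ^ (k + 1) = 1 := by
      rw [hpow, ZMod.natCast_self, AddMonoidAlgebra.one_def]
    obtain ⟨Q, hQ⟩ := (pow_dvd_pow_of_one_add_pow_eq_one p hp k T hT1 a).trans (pow_dvd_pow T hj)
    refine ⟨ev Q, ?_⟩
    change ev (T ^ j) = _
    rw [hQ, ← Nat.cast_pow, ← nsmul_eq_mul, map_nsmul, nsmul_eq_mul, Nat.cast_pow]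

section Filtration

variable {p : ℕ} [Fact p.Prime] {ι : Type*} [Fintype ι]

/-- The `i`-th coordinate function of the box parametrized by `σ`. -/
def boxCoord (σ : ι → ZMod p → ℤ_[p]) (i : ι) : (ι → ZMod p) → ℤ_[p] := fun b => σ i (b i)

/-- Functions on the box spanned by the `p ^ a * M`, with `M` a monomial in the coordinates of
degree at most `d + a * (p - 1)`. -/
noncomputable def boxFiltration (σ : ι → ZMod p → ℤ_[p]) (d : ℕ) :
    Submodule ℤ_[p] ((ι → ZMod p) → ℤ_[p]) :=
  Submodule.span ℤ_[p] {g | ∃ (a : ℕ) (E : ι → ℕ), ∑ i, E i ≤ d + a * (p - 1) ∧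
    g = (p : (ι → ZMod p) → ℤ_[p]) ^ a * ∏ i, boxCoord σ i ^ E i}

variable {σ : ι → ZMod p → ℤ_[p]}

theorem monomial_mem_boxFiltration {d : ℕ} (a : ℕ) (E : ι → ℕ) (h : ∑ i, E i ≤ d + a * (p - 1)) :
    (p : (ι → ZMod p) → ℤ_[p]) ^ a * ∏ i, boxCoord σ i ^ E i ∈ boxFiltration σ d :=
  Submodule.subset_span ⟨a, E, h, rfl⟩

theorem boxFiltration_mono {d e : ℕ} (h : d ≤ e) : boxFiltration σ d ≤ boxFiltration σ e := by
  refine Submodule.span_mono ?_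
  rintro g ⟨a, E, hE, rfl⟩
  exact ⟨a, E, by omega, rfl⟩

theorem one_mem_boxFiltration (d : ℕ) : 1 ∈ boxFiltration σ d := by
  simpa using monomial_mem_boxFiltration (σ := σ) (d := d) 0 0 (by simp)

theorem const_mem_boxFiltration (d : ℕ) (c : ℤ_[p]) :
    (fun _ => c) ∈ boxFiltration σ d := by
  have h := (boxFiltration σ d).smul_mem c (one_mem_boxFiltration d)
  convert h using 1
  ext b
  simp

theorem boxCoord_mem (i : ι) : boxCoord σ i ∈ boxFiltration σ 1 := by
  classical
  have h := monomial_mem_boxFiltration (σ := σ) (d := 1) 0 (Pi.single i 1) (by simp)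
  simpa [Pi.single_apply, pow_ite, Finset.prod_ite_eq'] using h

theorem mul_mem_boxFiltration {d e : ℕ} {g h : (ι → ZMod p) → ℤ_[p]}
    (hg : g ∈ boxFiltration σ d) (hh : h ∈ boxFiltration σ e) :
    g * h ∈ boxFiltration σ (d + e) := by
  have hle : boxFiltration σ d * boxFiltration σ e ≤ boxFiltration σ (d + e) := by
    rw [boxFiltration, boxFiltration, Submodule.span_mul_span, Submodule.span_le]
    rintro _ ⟨_, ⟨a, E, hE, rfl⟩, _, ⟨a', E', hE', rfl⟩, rfl⟩
    have hmem := monomial_mem_boxFiltration (σ := σ) (d := d + e) (a + a') (E + E') (by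
      simp only [Pi.add_apply, sum_add_distrib, add_mul]; omega)
    simp only [Pi.add_apply, pow_add, prod_mul_distrib] at hmem
    rwa [mul_mul_mul_comm] at hmem
  exact hle (Submodule.mul_mem_mul hg hh)

theorem prod_mem_boxFiltration {κ : Type*} (s : Finset κ) (d : κ → ℕ)
    (g : κ → (ι → ZMod p) → ℤ_[p]) (hg : ∀ k ∈ s, g k ∈ boxFiltration σ (d k)) :
    ∏ k ∈ s, g k ∈ boxFiltration σ (∑ k ∈ s, d k) := by
  classical
  induction s using Finset.induction_on with
  | empty => simpa using one_mem_boxFiltration 0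
  | insert k s hk ih =>
    rw [prod_insert hk, sum_insert hk]
    exact mul_mem_boxFiltration (hg k (mem_insert_self _ _))
      (ih fun l hl => hg l (mem_insert_of_mem hl))

theorem pow_mem_boxFiltration {d : ℕ} {g : (ι → ZMod p) → ℤ_[p]} (hg : g ∈ boxFiltration σ d)
    (r : ℕ) : g ^ r ∈ boxFiltration σ (r * d) := by
  simpa using prod_mem_boxFiltration (range r) (fun _ => d) (fun _ => g) fun _ _ => hg

theorem natCast_mul_mem_boxFiltration {d : ℕ} {g : (ι → ZMod p) → ℤ_[p]}
    (hg : g ∈ boxFiltration σ d) (c : ℕ) :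
    (c : (ι → ZMod p) → ℤ_[p]) * g ∈ boxFiltration σ d := by
  rw [← nsmul_eq_mul]
  exact Submodule.smul_of_tower_mem _ c hg

theorem prime_mul_mem_boxFiltration {d : ℕ} {g : (ι → ZMod p) → ℤ_[p]}
    (hg : g ∈ boxFiltration σ (d + (p - 1))) :
    (p : (ι → ZMod p) → ℤ_[p]) * g ∈ boxFiltration σ d := by
  induction hg using Submodule.span_induction with
  | mem g hg =>
    obtain ⟨a, E, hE, rfl⟩ := hg
    rw [← mul_assoc, ← pow_succ']
    exact monomial_mem_boxFiltration (a + 1) E (by rw [add_one_mul]; omega)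
  | zero => simp
  | add g h _ _ hg hh => rw [mul_add]; exact Submodule.add_mem _ hg hh
  | smul c g _ hg => rw [mul_smul_comm]; exact Submodule.smul_mem _ c hg

theorem prime_pow_mul_mem_boxFiltration {d : ℕ} (a : ℕ) {g : (ι → ZMod p) → ℤ_[p]}
    (hg : g ∈ boxFiltration σ (d + a * (p - 1))) :
    (p : (ι → ZMod p) → ℤ_[p]) ^ a * g ∈ boxFiltration σ d := by
  induction a generalizing d with
  | zero => simpa using hg
  | succ a ih =>
    rw [pow_succ', mul_assoc]
    refine prime_mul_mem_boxFiltration (ih ?_)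
    rwa [add_one_mul, add_comm (a * _), ← add_assoc] at hg

theorem isUnit_of_toZMod_ne_zero {x : ℤ_[p]} (hx : PadicInt.toZMod x ≠ 0) : IsUnit x := by
  by_contra h
  apply hx
  rw [← RingHom.mem_ker, PadicInt.ker_toZMod]
  exact (IsLocalRing.mem_maximalIdeal x).2 h

theorem prime_dvd_of_toZMod_eq_zero {x : ℤ_[p]} (hx : PadicInt.toZMod x = 0) :
    (p : ℤ_[p]) ∣ x := by
  rwa [← RingHom.mem_ker, PadicInt.ker_toZMod, PadicInt.maximalIdeal_eq_span_p,
    Ideal.mem_span_singleton] at hx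

theorem exists_prod_pow_prime {κ : Type*} (s : Finset κ) (d : κ → ℕ)
    (g : κ → (ι → ZMod p) → ℤ_[p]) (hg : ∀ k ∈ s, g k ∈ boxFiltration σ (d k))
    (hgp : ∀ k ∈ s, ∃ l ∈ boxFiltration σ (d k + (p - 1)), g k ^ p = g k + p * l) :
    ∃ l ∈ boxFiltration σ (∑ k ∈ s, d k + (p - 1)),
      (∏ k ∈ s, g k) ^ p = ∏ k ∈ s, g k + p * l := by
  classical
  induction s using Finset.induction_on with
  | empty => exact ⟨0, Submodule.zero_mem _, by simp⟩
  | insert k s hk ih =>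
    obtain ⟨x, hx, hxe⟩ := hgp k (mem_insert_self _ _)
    obtain ⟨y, hy, hye⟩ := ih (fun l hl => hg l (mem_insert_of_mem hl))
      fun l hl => hgp l (mem_insert_of_mem hl)
    have hgk := hg k (mem_insert_self _ _)
    have hgs := prod_mem_boxFiltration s d g fun l hl => hg l (mem_insert_of_mem hl)
    rw [prod_insert hk, sum_insert hk, mul_pow, hxe, hye]
    refine ⟨g k * y + x * ∏ k ∈ s, g k + p * (x * y), ?_, by ring⟩
    refine Submodule.add_mem _ (Submodule.add_mem _ ?_ ?_) (prime_mul_mem_boxFiltration ?_)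
    · exact boxFiltration_mono (by omega) (mul_mem_boxFiltration hgk hy)
    · exact boxFiltration_mono (by omega) (mul_mem_boxFiltration hx hgs)
    · exact boxFiltration_mono (by omega) (mul_mem_boxFiltration hx hy)

theorem indicator_coord_mem_boxFiltration
    (hσ : ∀ i t, PadicInt.toZMod (σ i t) = t) (i : ι) (t : ZMod p) :
    (fun b : ι → ZMod p => if b i = t then (1 : ℤ_[p]) else 0) ∈ boxFiltration σ (p - 1) := by
  classical
  have hunit : IsUnit (∏ s ∈ univ.erase t, (σ i t - σ i s)) := by
    refine isUnit_of_toZMod_ne_zero ?_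
    simp only [map_prod, map_sub, hσ]
    exact prod_ne_zero_iff.2 fun s hs => sub_ne_zero.2 (ne_of_mem_erase hs).symm
  obtain ⟨u, hu⟩ := hunit
  have hmem : ∏ s ∈ univ.erase t, (boxCoord σ i - fun _ => σ i s) ∈
      boxFiltration σ (∑ s ∈ univ.erase t, 1) :=
    prod_mem_boxFiltration _ (fun _ => 1) _ fun s _ =>
      Submodule.sub_mem _ (boxCoord_mem i) (const_mem_boxFiltration _ _)
  rw [sum_const, card_erase_of_mem (mem_univ _), card_univ, ZMod.card, smul_eq_mul, mul_one] at hmem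
  convert Submodule.smul_mem _ ((u⁻¹ : ℤ_[p]ˣ) : ℤ_[p]) hmem using 1
  ext b : 1
  simp only [Pi.smul_apply, Finset.prod_apply, Pi.sub_apply, boxCoord, smul_eq_mul]
  split_ifs with h
  · rw [h, ← hu, Units.inv_mul]
  · have hzero : ∏ s ∈ univ.erase t, (σ i (b i) - σ i s) = 0 :=
      prod_eq_zero (mem_erase.2 ⟨h, mem_univ _⟩) (sub_self _)
    rw [hzero, mul_zero]

theorem coord_function_mem_boxFiltration
    (hσ : ∀ i t, PadicInt.toZMod (σ i t) = t) (i : ι) (h : ZMod p → ℤ_[p]) :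
    (fun b : ι → ZMod p => h (b i)) ∈ boxFiltration σ (p - 1) := by
  have hsum : (fun b : ι → ZMod p => h (b i)) =
      ∑ t, h t • fun b : ι → ZMod p => if b i = t then (1 : ℤ_[p]) else 0 := by
    ext b
    simp [Finset.sum_apply]
  rw [hsum]
  exact Submodule.sum_mem _ fun t _ =>
    Submodule.smul_mem _ _ (indicator_coord_mem_boxFiltration hσ i t)

theorem prime_pow_card_mul_mem_boxFiltration
    (hσ : ∀ i t, PadicInt.toZMod (σ i t) = t) (g : (ι → ZMod p) → ℤ_[p]) :
    (p : (ι → ZMod p) → ℤ_[p]) ^ Fintype.card ι * g ∈ boxFiltration σ 0 := by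
  classical
  refine prime_pow_mul_mem_boxFiltration _ ?_
  have hsum : g = ∑ t : ι → ZMod p, g t •
      ∏ i, fun b : ι → ZMod p => if b i = t i then (1 : ℤ_[p]) else 0 := by
    ext b
    rw [Finset.sum_apply, sum_eq_single b]
    · simp
    · intro t _ ht
      obtain ⟨i, hi⟩ := Function.ne_iff.1 ht
      simp only [Pi.smul_apply, Finset.prod_apply]
      rw [prod_eq_zero (mem_univ i) (if_neg hi.symm), smul_zero]
    · simp
  rw [hsum]
  refine Submodule.sum_mem _ fun t _ => Submodule.smul_mem _ _ ?_
  have h := prod_mem_boxFiltration univ (fun _ : ι => p - 1) _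
    fun i _ => indicator_coord_mem_boxFiltration hσ i (t i)
  simpa using h

theorem exists_boxCoord_pow_prime
    (hσ : ∀ i t, PadicInt.toZMod (σ i t) = t) (i : ι) :
    ∃ k ∈ boxFiltration σ (1 + (p - 1)), boxCoord σ i ^ p = boxCoord σ i + p * k := by
  have hdvd : ∀ t, (p : ℤ_[p]) ∣ σ i t ^ p - σ i t := fun t =>
    prime_dvd_of_toZMod_eq_zero (by simp)
  choose h hh using hdvd
  refine ⟨fun b => h (b i),
    boxFiltration_mono (by omega) (coord_function_mem_boxFiltration hσ i h), ?_⟩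
  ext b : 1
  simpa [boxCoord] using sub_eq_iff_eq_add'.1 (hh (b i))

theorem exists_monomial_pow_prime
    (hσ : ∀ i t, PadicInt.toZMod (σ i t) = t) (E : ι → ℕ) :
    ∃ k ∈ boxFiltration σ (∑ i, E i + (p - 1)),
      (∏ i, boxCoord σ i ^ E i) ^ p = ∏ i, boxCoord σ i ^ E i + p * k := by
  refine exists_prod_pow_prime univ E _
    (fun i _ => by simpa using pow_mem_boxFiltration (boxCoord_mem i) (E i)) fun i _ => ?_
  simpa using exists_prod_pow_prime (range (E i)) (fun _ => 1) (fun _ => boxCoord σ i)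
    (fun _ _ => boxCoord_mem i) fun _ _ => exists_boxCoord_pow_prime hσ i

theorem exists_generator_pow_prime
    (hσ : ∀ i t, PadicInt.toZMod (σ i t) = t) {d : ℕ} (a : ℕ) (E : ι → ℕ)
    (h : ∑ i, E i ≤ d + a * (p - 1)) :
    ∃ k ∈ boxFiltration σ (d + (p - 1)),
      ((p : (ι → ZMod p) → ℤ_[p]) ^ a * ∏ i, boxCoord σ i ^ E i) ^ p =
        (p : (ι → ZMod p) → ℤ_[p]) ^ a * ∏ i, boxCoord σ i ^ E i + p * k := by
  induction a generalizing d with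
  | zero =>
    obtain ⟨k, hk, hke⟩ := exists_monomial_pow_prime hσ E
    exact ⟨k, boxFiltration_mono (by omega) hk, by simpa using hke⟩
  | succ a ih =>
    have h' : ∑ i, E i ≤ d + (p - 1) + a * (p - 1) := by rw [add_one_mul] at h; omega
    obtain ⟨k, hk, hke⟩ := ih h'
    have hg := monomial_mem_boxFiltration (σ := σ) a E h'
    rw [pow_succ', mul_assoc]
    set g := (p : (ι → ZMod p) → ℤ_[p]) ^ a * ∏ i, boxCoord σ i ^ E i
    refine ⟨(p ^ (p - 1) : ℕ) * g + (p ^ (p - 1) : ℕ) * (p * k) - g, ?_, ?_⟩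
    · exact Submodule.sub_mem _ (Submodule.add_mem _ (natCast_mul_mem_boxFiltration hg _)
        (natCast_mul_mem_boxFiltration (prime_mul_mem_boxFiltration hk) _)) hg
    · have hp : (p : (ι → ZMod p) → ℤ_[p]) ^ p = p * p ^ (p - 1) := by
        rw [← pow_succ', Nat.sub_add_cancel (Fact.out : p.Prime).one_le]
      rw [mul_pow, hke, hp]
      push_cast
      ring

theorem exists_pow_prime_of_mem_boxFiltration
    (hσ : ∀ i t, PadicInt.toZMod (σ i t) = t) {d : ℕ} (hd : 1 ≤ d) {g : (ι → ZMod p) → ℤ_[p]}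
    (hg : g ∈ boxFiltration σ d) : ∃ k ∈ boxFiltration σ (p * d), g ^ p = g + p * k := by
  have hp : p.Prime := Fact.out
  have hpd : d + (p - 1) ≤ p * d := by
    obtain ⟨q, rfl⟩ : ∃ q, p = q + 1 := ⟨p - 1, by have := hp.one_le; omega⟩
    have : q * 1 ≤ q * d := Nat.mul_le_mul_left _ hd
    rw [add_one_mul, Nat.add_sub_cancel]
    omega
  induction hg using Submodule.span_induction with
  | mem g hg =>
    obtain ⟨a, E, hE, rfl⟩ := hg
    obtain ⟨k, hk, hke⟩ := exists_generator_pow_prime hσ a E hE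
    exact ⟨k, boxFiltration_mono hpd hk, hke⟩
  | zero => exact ⟨0, Submodule.zero_mem _, by simp [hp.ne_zero]⟩
  | add g h hg hh ihg ihh =>
    obtain ⟨k, hk, hke⟩ := ihg
    obtain ⟨l, hl, hle⟩ := ihh
    refine ⟨k + l + ∑ i ∈ Ioo 0 p, g ^ i * h ^ (p - i) * ((p.choose i / p : ℕ) :
      (ι → ZMod p) → ℤ_[p]), ?_, by rw [add_pow_prime_eq' hp, hke, hle]; ring⟩
    refine Submodule.add_mem _ (Submodule.add_mem _ hk hl) (Submodule.sum_mem _ fun i hi => ?_)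
    have hi' := (mem_Ioo.1 hi).2.le
    have hmem : g ^ i * h ^ (p - i) ∈ boxFiltration σ (i * d + (p - i) * d) :=
      mul_mem_boxFiltration (pow_mem_boxFiltration hg i) (pow_mem_boxFiltration hh (p - i))
    rw [← add_mul, Nat.add_sub_cancel' hi'] at hmem
    rw [mul_comm (g ^ i * h ^ (p - i))]
    exact natCast_mul_mem_boxFiltration hmem _
  | smul c g hg ihg =>
    obtain ⟨k, hk, hke⟩ := ihg
    obtain ⟨e, he⟩ : (p : ℤ_[p]) ∣ c ^ p - c := prime_dvd_of_toZMod_eq_zero (by simp)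
    have hg' : g ∈ boxFiltration σ (p * d) :=
      boxFiltration_mono ((Nat.le_add_right _ _).trans hpd) hg
    refine ⟨e • g + c • k + e • (p * k), Submodule.add_mem _ (Submodule.add_mem _
      (Submodule.smul_mem _ _ hg') (Submodule.smul_mem _ _ hk))
      (Submodule.smul_mem _ _ (natCast_mul_mem_boxFiltration hk _)), ?_⟩
    ext b : 1
    have hb := congrFun hke b
    simp only [Pi.pow_apply, Pi.add_apply, Pi.mul_apply, Pi.smul_apply, smul_eq_mul,
      Pi.natCast_apply] at hb ⊢
    rw [mul_pow, hb]
    linear_combination (g b + p * k b) * he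

/-- Binomial coefficients of functions in the filtration stay in the filtration. -/
theorem choose_mem_boxFiltration
    (hσ : ∀ i t, PadicInt.toZMod (σ i t) = t) (j : ℕ) {d : ℕ} (hd : 1 ≤ d) (g : (ι → ZMod p) → ℕ)
    (hg : (fun b => (g b : ℤ_[p])) ∈ boxFiltration σ d) :
    (fun b => ((g b).choose j : ℤ_[p])) ∈ boxFiltration σ (j * d) := by
  have hp : p.Prime := Fact.out
  induction j using Nat.strong_induction_on generalizing d g with
  | _ j ih =>
  rcases Nat.eq_zero_or_pos j with rfl | hj
  · simpa using const_mem_boxFiltration 0 1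
  obtain ⟨c, hc, hctop⟩ := exists_choose_expansion p hp (j / p) (j % p) (Nat.mod_lt _ hp.pos)
  rw [Nat.div_add_mod] at hctop
  simp only [Nat.div_add_mod] at hc
  have hpd : 1 ≤ p * d := Nat.mul_pos hp.pos hd
  have hδ : (fun b => (((g b ^ p - g b) / p : ℕ) : ℤ_[p])) ∈ boxFiltration σ (p * d) := by
    obtain ⟨k, hk, hke⟩ := exists_pow_prime_of_mem_boxFiltration hσ hd hg
    convert hk using 1
    ext b : 1
    have hb := congrFun hke b
    simp only [Pi.pow_apply, Pi.add_apply, Pi.mul_apply, Pi.natCast_apply] at hb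
    have hp0 : (p : ℤ_[p]) ≠ 0 := by exact_mod_cast hp.ne_zero
    refine mul_left_cancel₀ hp0 ?_
    rw [← Nat.cast_mul, Nat.mul_div_cancel' (dvd_pow_prime_sub_self p hp (g b)),
      Nat.cast_sub (Nat.le_self_pow hp.ne_zero _), Nat.cast_pow, hb, add_sub_cancel_left]
  have hleft : (fun b => (g b : ℤ_[p]) ^ (j % p) *
      (((g b ^ p - g b) / p).choose (j / p) : ℤ_[p])) ∈ boxFiltration σ (j * d) := by
    have hmem := mul_mem_boxFiltration (pow_mem_boxFiltration hg (j % p))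
      (ih (j / p) (Nat.div_lt_self hj hp.one_lt) hpd _ hδ)
    rwa [← mul_assoc, ← add_mul, mul_comm (j / p), Nat.mod_add_div] at hmem
  have hunit : IsUnit ((c j : ℤ) : ℤ_[p]) := isUnit_of_toZMod_ne_zero (by
    rw [map_intCast]
    exact fun h => hctop ((ZMod.intCast_zmod_eq_zero_iff_dvd _ _).1 h))
  obtain ⟨u, hu⟩ := hunit
  have hlower : (fun b => ∑ i ∈ range j, ((c i : ℤ) : ℤ_[p]) * ((g b).choose i : ℤ_[p])) ∈
      boxFiltration σ (j * d) := by
    have hsum := Submodule.sum_mem (boxFiltration σ (j * d)) (t := range j)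
      (f := fun i => ((c i : ℤ) : ℤ_[p]) • fun b => ((g b).choose i : ℤ_[p])) fun i hi =>
        Submodule.smul_mem _ _ (boxFiltration_mono
          (Nat.mul_le_mul_right d (mem_range.1 hi).le) (ih i (mem_range.1 hi) hd g hg))
    convert hsum using 1
    ext b
    simp [Finset.sum_apply]
  convert Submodule.smul_mem _ ((u⁻¹ : ℤ_[p]ˣ) : ℤ_[p]) (Submodule.sub_mem _ hleft hlower) using 1
  ext b : 1
  have hb := congrArg (fun z : ℤ => (z : ℤ_[p])) (hc (g b))
  simp only [sum_range_succ] at hb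
  push_cast at hb
  simp only [Pi.smul_apply, Pi.sub_apply, smul_eq_mul]
  rw [hb, add_sub_cancel_left, ← hu, ← mul_assoc, Units.inv_mul, one_mul]

theorem pow_dvd_sum_of_mem_boxFiltration
    (hσ : ∀ i t, PadicInt.toZMod (σ i t) = t) [DecidableEq ι] {d N : ℕ}
    (hN : N * (p - 1) + d < (Fintype.card ι + 1) * (p - 1))
    {g : (ι → ZMod p) → ℤ_[p]} (hg : g ∈ boxFiltration σ d) : (p : ℤ_[p]) ^ N ∣ ∑ b, g b := by
  induction hg using Submodule.span_induction with
  | mem g hg =>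
    obtain ⟨a, E, hE, rfl⟩ := hg
    simp only [Pi.mul_apply, Pi.pow_apply, Pi.natCast_apply, Finset.prod_apply, boxCoord,
      ← mul_sum]
    rw [← Fintype.piFinset_univ, sum_prod_piFinset univ fun i t => σ i t ^ E i]
    set S : Finset ι := {i | E i < p - 1} with hS
    have hdvd : (p : ℤ_[p]) ^ (a + #S) ∣ (p : ℤ_[p]) ^ a * ∏ i, ∑ t, σ i t ^ E i := by
      rw [pow_add]
      refine mul_dvd_mul_left _ ?_
      refine dvd_trans ?_ (prod_dvd_prod_of_subset S univ _ (subset_univ _))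
      rw [← prod_const]
      refine prod_dvd_prod_of_dvd _ _ fun i hi => prime_dvd_of_toZMod_eq_zero ?_
      simp only [map_sum, map_pow, hσ]
      refine FiniteField.sum_pow_lt_card_sub_one _ _ ?_
      rw [ZMod.card]
      exact (mem_filter.1 hi).2
    refine (pow_dvd_pow _ ?_).trans hdvd
    have hcard : #Sᶜ * (p - 1) ≤ ∑ i, E i := by
      rw [← smul_eq_mul]
      refine (card_nsmul_le_sum Sᶜ E (p - 1) fun i hi => ?_).trans
        (sum_le_sum_of_subset (subset_univ _))
      simpa [hS] using hi
    have hc := card_add_card_compl S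
    rw [← hc] at hN
    by_contra! hlt
    have h1 : (a + #S + 1) * (p - 1) ≤ N * (p - 1) := Nat.mul_le_mul_right _ hlt
    simp only [add_mul] at h1 hN
    omega
  | zero => simp
  | add g h _ _ hg hh =>
    simp only [Pi.add_apply, sum_add_distrib]
    exact dvd_add hg hh
  | smul c g _ hg =>
    simp only [Pi.smul_apply, ← smul_sum]
    exact hg.mul_left c

theorem eval_mem_boxFiltration (f : MvPolynomial ι ℤ_[p]) :
    (fun b => MvPolynomial.eval (fun i => σ i (b i)) f) ∈ boxFiltration σ f.totalDegree := by
  have hmem := Submodule.sum_mem (boxFiltration σ f.totalDegree) (t := f.support)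
    (f := fun E => f.coeff E • ((p : (ι → ZMod p) → ℤ_[p]) ^ 0 * ∏ i, boxCoord σ i ^ E i))
    fun E hE => Submodule.smul_mem _ _ (monomial_mem_boxFiltration 0 E (by
      simpa [Finsupp.sum_fintype] using MvPolynomial.le_totalDegree hE))
  convert hmem using 1
  ext b
  simp [MvPolynomial.eval_eq', Finset.sum_apply, Finset.prod_apply, boxCoord]

end Filtration

/-- A bound for `j` in terms of the guaranteed divisibility of the `j`-th coefficient. -/
theorem exists_divisibility_exponent (p : ℕ) (hp : p.Prime) (k j : ℕ) :
    ∃ a : ℕ, (p ^ k + a * (p ^ k * (p - 1)) ≤ j ∨ a = 0) ∧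
      j ≤ (p - 1) * (a * p ^ k + ∑ i ∈ range (k + 1), p ^ i) := by
  have hgeom : (p - 1) * ∑ i ∈ range (k + 1), p ^ i = p ^ (k + 1) - 1 := by
    have h := geom_sum_mul_add (p - 1) (k + 1)
    rw [Nat.sub_add_cancel hp.one_le, mul_comm] at h
    omega
  set φ := p ^ k * (p - 1) with hφ
  have hφpos : 0 < φ := Nat.mul_pos (pow_pos hp.pos k) (by have := hp.two_le; omega)
  have hpow : p ^ (k + 1) = φ + p ^ k := by
    rw [hφ, ← Nat.mul_succ, Nat.succ_eq_add_one, Nat.sub_add_cancel hp.one_le, pow_succ]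
  refine ⟨(j - p ^ k) / φ, ?_, ?_⟩
  · have := Nat.div_mul_le_self (j - p ^ k) φ
    rcases le_or_gt (p ^ k) j with h | h
    · left; omega
    · right; rw [Nat.sub_eq_zero_of_le h.le, Nat.zero_div]
  · have h := Nat.lt_div_mul_add (a := j - p ^ k) hφpos
    have hcomm : (p - 1) * ((j - p ^ k) / φ * p ^ k) = (j - p ^ k) / φ * φ := by
      rw [hφ]; ring
    have := pow_pos hp.pos k
    rw [mul_add, hgeom, hpow, hcomm]
    omega

theorem ceil_exponent_bound (n S D A t : ℕ) (hD : 0 < D)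
    (ht : (t : ℤ) = max 0 ⌈((n : ℚ) - S) / D⌉) (hA : A < t) : t - A + (D * A + S) ≤ n := by
  have hpos : 0 < ⌈((n : ℚ) - S) / D⌉ := by
    by_contra! h
    rw [max_eq_left h] at ht
    omega
  rw [max_eq_right hpos.le] at ht
  have hlt : (((t : ℤ) - 1 : ℤ) : ℚ) < ((n : ℚ) - S) / D := by
    rw [← Int.lt_ceil, ← ht]
    omega
  rw [lt_div_iff₀ (by exact_mod_cast hD)] at hlt
  have hlt' : ((t : ℤ) - 1) * D < n - S := by exact_mod_cast hlt
  obtain ⟨e, rfl⟩ : ∃ e, t = A + e + 1 := ⟨t - A - 1, by omega⟩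
  push_cast at hlt'
  zify
  rw [Nat.cast_sub (by omega)]
  push_cast
  have : (0 : ℤ) ≤ e * (D - 1) := mul_nonneg (by positivity) (by omega)
  nlinarith

theorem dvd_iff_dvd_appr {p : ℕ} [Fact p.Prime] (y : ℤ_[p]) {m N : ℕ} (h : m ≤ N) :
    (p : ℤ_[p]) ^ m ∣ y ↔ p ^ m ∣ y.appr N := by
  have hy : (p : ℤ_[p]) ^ m ∣ y - y.appr N :=
    (pow_dvd_pow _ h).trans (Ideal.mem_span_singleton.1 (PadicInt.appr_spec N y))
  rw [dvd_iff_dvd_of_dvd_sub hy]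
  have := PadicInt.pow_p_dvd_int_iff (p := p) m (y.appr N)
  rw [Int.cast_natCast] at this
  rw [this]
  exact_mod_cast Iff.rfl

theorem choose_appr_eval_mem_boxFiltration {p : ℕ} [Fact p.Prime] {ι : Type*} [Fintype ι]
    {σ : ι → ZMod p → ℤ_[p]} (hσ : ∀ i t, PadicInt.toZMod (σ i t) = t)
    (f : MvPolynomial ι ℤ_[p]) {N : ℕ} (hN : Fintype.card ι ≤ N) (j : ℕ) :
    (fun b => (((MvPolynomial.eval (fun i => σ i (b i)) f).appr N).choose j : ℤ_[p])) ∈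
      boxFiltration σ (j * f.totalDegree) := by
  rcases Nat.eq_zero_or_pos f.totalDegree with hd | hd
  · rw [MvPolynomial.totalDegree_eq_zero_iff_eq_C] at hd
    rw [hd]
    simpa only [MvPolynomial.eval_C] using const_mem_boxFiltration _ _
  · refine choose_mem_boxFiltration hσ j hd _ ?_
    have hdvd : ∀ b : ι → ZMod p, ∃ e : ℤ_[p], MvPolynomial.eval (fun i => σ i (b i)) f -
        ((MvPolynomial.eval (fun i => σ i (b i)) f).appr N : ℤ_[p]) = p ^ Fintype.card ι * e :=
      fun b => (pow_dvd_pow _ hN).trans (Ideal.mem_span_singleton.1 (PadicInt.appr_spec N _))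
    choose e he using hdvd
    convert Submodule.sub_mem _ (eval_mem_boxFiltration (σ := σ) f)
      (boxFiltration_mono (Nat.zero_le _) (prime_pow_card_mul_mem_boxFiltration hσ e)) using 1
    ext b : 1
    simp [← he b]

/-- The divisibility theorem for the parametrized box, with an arbitrary exponent `t`. -/
theorem pow_dvd_card_box_zeros {p : ℕ} [Fact p.Prime] {ι κ : Type*} [Fintype ι] [DecidableEq ι]
    [Fintype κ] {σ : ι → ZMod p → ℤ_[p]} (hσ : ∀ i t, PadicInt.toZMod (σ i t) = t)
    (f : κ → MvPolynomial ι ℤ_[p]) (m : κ → ℕ) (D t : ℕ)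
    (hD : ∀ k, p ^ m k * (f k).totalDegree ≤ D)
    (ht : ∀ A < t, t - A + (D * A + ∑ k, (∑ i ∈ range (m k + 1), p ^ i) * (f k).totalDegree) ≤
      Fintype.card ι) :
    (p : ℤ_[p]) ^ t ∣ ∑ b : ι → ZMod p, ∏ k, open Classical in
      if (p : ℤ_[p]) ^ (m k + 1) ∣ MvPolynomial.eval (fun i => σ i (b i)) (f k) then
        (1 : ℤ_[p]) else 0 := by
  classical
  have hp : p.Prime := Fact.out
  set N := Fintype.card ι + ∑ k, (m k + 1) with hN
  have hmN : ∀ k, m k + 1 ≤ N := fun k =>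
    (single_le_sum (f := fun k => m k + 1) (fun _ _ => Nat.zero_le _) (mem_univ k)).trans
      (Nat.le_add_left _ _)
  choose c hc hcdvd using fun k => exists_indicator_expansion ℤ_[p] p hp (m k)
  have hexp : ∀ b : ι → ZMod p, (∏ k,
      if (p : ℤ_[p]) ^ (m k + 1) ∣ MvPolynomial.eval (fun i => σ i (b i)) (f k) then
        (1 : ℤ_[p]) else 0) = ∑ j ∈ Fintype.piFinset fun _ : κ => range (p ^ N), ∏ k, c k (j k) *
        (((MvPolynomial.eval (fun i => σ i (b i)) (f k)).appr N).choose (j k) : ℤ_[p]) := by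
    intro b
    rw [sum_prod_piFinset (range (p ^ N)) fun k j => c k j *
        (((MvPolynomial.eval (fun i => σ i (b i)) (f k)).appr N).choose j : ℤ_[p])]
    refine prod_congr rfl fun k _ => ?_
    rw [← hc k _ _ (PadicInt.appr_lt _ _)]
    simp only [dvd_iff_dvd_appr _ (hmN k)]
  simp only [hexp]
  rw [sum_comm]
  refine dvd_sum fun j _ => ?_
  simp only [prod_mul_distrib, ← mul_sum]
  choose a ha hja using fun k => exists_divisibility_exponent p hp (m k) (j k)
  have hcoef : (p : ℤ_[p]) ^ ∑ k, a k ∣ ∏ k, c k (j k) := by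
    rw [← prod_pow_eq_pow_sum]
    refine prod_dvd_prod_of_dvd _ _ fun k _ => ?_
    rcases ha k with h | h
    · exact hcdvd k _ _ h
    · simp [h]
  set A := ∑ k, a k with hA
  rcases le_or_gt t A with htA | htA
  · exact ((pow_dvd_pow _ htA).trans hcoef).mul_right _
  rw [← Nat.add_sub_cancel' htA.le, pow_add]
  refine mul_dvd_mul hcoef ?_
  have hmem := prod_mem_boxFiltration univ (fun k => j k * (f k).totalDegree) _
    fun k _ => choose_appr_eval_mem_boxFiltration hσ (f k) (N := N) (Nat.le_add_right _ _) (j k)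
  have hsum := pow_dvd_sum_of_mem_boxFiltration hσ (N := t - A) ?_ hmem
  · simpa only [Finset.prod_apply] using hsum
  have hbound : ∑ k, j k * (f k).totalDegree ≤ (p - 1) * (D * A +
      ∑ k, (∑ i ∈ range (m k + 1), p ^ i) * (f k).totalDegree) := by
    rw [hA, mul_sum, ← sum_add_distrib, mul_sum]
    refine sum_le_sum fun k _ => (Nat.mul_le_mul_right _ (hja k)).trans ?_
    rw [mul_assoc]
    refine Nat.mul_le_mul_left _ ?_
    rw [add_mul]
    refine Nat.add_le_add_right ?_ _
    rw [mul_assoc, mul_comm D]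
    exact Nat.mul_le_mul_left _ (hD k)
  have hp1 : 1 ≤ p - 1 := by have := hp.two_le; omega
  have hfin := Nat.mul_le_mul_left (p - 1) (ht A htA)
  rw [mul_add] at hfin
  rw [add_mul, one_mul, mul_comm (t - A), mul_comm (Fintype.card ι)]
  omega

/-- Grynkiewicz's theorem: for a split box `𝓑 = I_1 × ⋯ × I_n ⊆ ℤ_p^n` with each `I_j` a
complete system of residues modulo `p`, nonzero `f_1,…,f_s ∈ ℤ_p[x_1,…,x_n]`, `m_k ≥ 1`,
and `V = {X ∈ 𝓑 : p^{m_k} ∣ f_k(X) ∀k}`, one has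
`ord_p |V| ≥ ⌈(n − Σ_k ((p^{m_k}−1)/(p−1))·deg f_k) / max_k (p^{m_k−1}·deg f_k)⌉*`. -/
theorem stmt17 (p n s : ℕ) [Fact p.Prime] (hn : 0 < n) (hs : 0 < s)
    (I : Fin n → Set ℤ_[p])
    (hI : ∀ j, Set.BijOn (PadicInt.toZMod : ℤ_[p] → ZMod p) (I j) Set.univ)
    (f : Fin s → MvPolynomial (Fin n) ℤ_[p]) (hf : ∀ k, f k ≠ 0)
    (m : Fin s → ℕ) (hm : ∀ k, 1 ≤ m k) :
    p ^ (max 0 ⌈((n : ℚ) -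
          ∑ k, ((p : ℚ) ^ m k - 1) / ((p : ℚ) - 1) * (f k).totalDegree) /
        ((Finset.univ.sup fun k => p ^ (m k - 1) * (f k).totalDegree : ℕ) : ℚ)⌉).toNat ∣
      {X : Fin n → ℤ_[p] | (∀ j, X j ∈ I j) ∧
        ∀ k, (p : ℤ_[p]) ^ m k ∣ MvPolynomial.eval X (f k)}.ncard := by
  classical
  have hp : p.Prime := Fact.out
  choose σ hσI hσ using fun j t => (hI j).surjOn (Set.mem_univ t)
  set S : ℕ := ∑ k, (∑ i ∈ range (m k - 1 + 1), p ^ i) * (f k).totalDegree with hS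
  set D : ℕ := univ.sup fun k => p ^ (m k - 1) * (f k).totalDegree with hD
  have hScast : ∑ k, ((p : ℚ) ^ m k - 1) / ((p : ℚ) - 1) * (f k).totalDegree = (S : ℚ) := by
    rw [hS]
    push_cast
    refine sum_congr rfl fun k _ => ?_
    rw [Nat.sub_add_cancel (hm k), geom_sum_eq (by exact_mod_cast hp.ne_one)]
  rw [hScast]
  rcases Nat.eq_zero_or_pos D with hD0 | hDpos
  · simp [hD0]
  set t := (max 0 ⌈((n : ℚ) - S) / D⌉).toNat with ht
  have htcast : (t : ℤ) = max 0 ⌈((n : ℚ) - S) / D⌉ := Int.toNat_of_nonneg (le_max_left _ _)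
  have hmain := pow_dvd_card_box_zeros hσ f (fun k => m k - 1) D t
    (fun k => le_sup (f := fun k => p ^ (m k - 1) * (f k).totalDegree) (mem_univ k))
    (fun A hA => by simpa using ceil_exponent_bound n S D A t hDpos htcast hA)
  simp only [Nat.sub_add_cancel (hm _)] at hmain
  have hset : {X : Fin n → ℤ_[p] | (∀ j, X j ∈ I j) ∧
      ∀ k, (p : ℤ_[p]) ^ m k ∣ MvPolynomial.eval X (f k)} =
      ((univ.filter fun b : Fin n → ZMod p => ∀ k, (p : ℤ_[p]) ^ m k ∣
        MvPolynomial.eval (fun j => σ j (b j)) (f k)).image fun b j => σ j (b j) :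
          Finset (Fin n → ℤ_[p])) := by
    ext X
    simp only [Set.mem_ofPred_eq, coe_image, coe_filter, mem_univ, true_and, Set.mem_image]
    constructor
    · rintro ⟨hX, hdvd⟩
      have hXσ : (fun j => σ j (PadicInt.toZMod (X j))) = X := funext fun j =>
        (hI j).injOn (hσI _ _) (hX j) (hσ _ _)
      exact ⟨fun j => PadicInt.toZMod (X j), by simpa only [hXσ] using hdvd, hXσ⟩
    · rintro ⟨b, hb, rfl⟩
      exact ⟨fun j => hσI _ _, hb⟩
  have hinj : Function.Injective fun (b : Fin n → ZMod p) j => σ j (b j) := by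
    intro b b' h
    ext j : 1
    rw [← hσ j (b j), ← hσ j (b' j)]
    exact congrArg _ (congrFun h j)
  rw [hset, Set.ncard_coe_finset, card_image_of_injective _ hinj]
  simp only [prod_boole, mem_univ, true_imp_iff, sum_boole] at hmain
  have hcast := PadicInt.pow_p_dvd_int_iff (p := p) t
    (#{b : Fin n → ZMod p | ∀ k, (p : ℤ_[p]) ^ m k ∣
      MvPolynomial.eval (fun j => σ j (b j)) (f k)} : ℕ)
  rw [Int.cast_natCast] at hcast
  exact_mod_cast hcast.1 hmain
end
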